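/- Let Ω ⊆ ℂⁿ be a pseudoconvex domain (nonempty, open, connected, admitting a smooth plurisubharmonic exhaustion function), and suppose there exist a real-valued function φ, twice continuously differentiable on Ω, and constants A, B > 0 such that |φ(z)| ≤ A for all z ∈ Ω and Hφ(z; ξ) ≥ B|ξ|² for all z ∈ Ω and ξ ∈ ℂⁿ. Then ∂̄ has closed range: R(∂̄) = {α ∈ (L²(Ω))ⁿ : ∃u ∈ L²(Ω) with ∂̄u = α distributionally on Ω} is closed in (L²(Ω))ⁿ. -/

import Mathlib

open MeasureTheory Complex Metric Set

noncomputable section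

/-- The Wirtinger derivative `∂φ/∂z̄_j` of `φ : ℂⁿ → ℂ`:
`(1/2)(Dφ_z(e_j) + i·Dφ_z(i·e_j))`. -/
def dbarCoord (n : ℕ) (φ : (Fin n → ℂ) → ℂ) (j : Fin n) (z : Fin n → ℂ) : ℂ :=
  (1 / 2) * (fderiv ℝ φ z (Pi.single j 1) + Complex.I * fderiv ℝ φ z (Pi.single j Complex.I))

/-- A test function on `Ω`: smooth with compact support contained in `Ω`. -/
def IsTest (n : ℕ) (Ω : Set (Fin n → ℂ)) (φ : (Fin n → ℂ) → ℂ) : Prop :=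
  ContDiff ℝ (⊤ : ℕ∞) φ ∧ HasCompactSupport φ ∧ tsupport φ ⊆ Ω

/-- `∂̄u = α` distributionally on `Ω`. -/
def DbarEq (n : ℕ) (Ω : Set (Fin n → ℂ)) (u : (Fin n → ℂ) → ℂ)
    (α : Fin n → (Fin n → ℂ) → ℂ) : Prop :=
  ∀ j : Fin n, ∀ φ : (Fin n → ℂ) → ℂ, IsTest n Ω φ →
    ∫ z in Ω, α j z * φ z = - ∫ z in Ω, u z * dbarCoord n φ j z

/-- `α` is `∂̄`-closed on `Ω`. -/
def DbarClosed (n : ℕ) (Ω : Set (Fin n → ℂ)) (α : Fin n → (Fin n → ℂ) → ℂ) : Prop :=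
  ∀ j k : Fin n, ∀ φ : (Fin n → ℂ) → ℂ, IsTest n Ω φ →
    ∫ z in Ω, α j z * dbarCoord n φ k z = ∫ z in Ω, α k z * dbarCoord n φ j z

/-- The complex Hessian `Hf(z;ξ) = (1/4)(D²f_z(ξ,ξ) + D²f_z(iξ,iξ))`. -/
def hessC (n : ℕ) (f : (Fin n → ℂ) → ℝ) (z ξ : Fin n → ℂ) : ℝ :=
  (1 / 4) * (iteratedFDeriv ℝ 2 f z ![ξ, ξ]
    + iteratedFDeriv ℝ 2 f z ![Complex.I • ξ, Complex.I • ξ])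

/-- The pairing `⟨∂f(z), ξ⟩ = (1/2)(Df_z(ξ) − i·Df_z(iξ))`. -/
def delPair (n : ℕ) (f : (Fin n → ℂ) → ℝ) (z ξ : Fin n → ℂ) : ℂ :=
  (1 / 2) * ((fderiv ℝ f z ξ : ℂ) - Complex.I * (fderiv ℝ f z (Complex.I • ξ) : ℂ))

/-- Squared Euclidean norm of `ξ ∈ ℂⁿ`. -/
def enormSq (n : ℕ) (ξ : Fin n → ℂ) : ℝ := ∑ j, Complex.normSq (ξ j)

/-- The twisted curvature expression
`Θ_{λ,τ}(z;ξ) = τ(z)·Hλ(z;ξ) − Hτ(z;ξ) − τ(z)⁻¹·|⟨∂τ(z),ξ⟩|²`. -/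
def Theta (n : ℕ) (lam tau : (Fin n → ℂ) → ℝ) (z ξ : Fin n → ℂ) : ℝ :=
  tau z * hessC n lam z ξ - hessC n tau z ξ - (tau z)⁻¹ * Complex.normSq (delPair n tau z ξ)

/-- `Φ` is an exhaustion function of `Ω`: every sublevel set has compact closure inside `Ω`. -/
def ExhaustsOn (n : ℕ) (Ω : Set (Fin n → ℂ)) (Φ : (Fin n → ℂ) → ℝ) : Prop :=
  ∀ c : ℝ, IsCompact (closure {z ∈ Ω | Φ z < c}) ∧ closure {z ∈ Ω | Φ z < c} ⊆ Ω

/-- `Ω` is pseudoconvex: it admits a smooth plurisubharmonic exhaustion function. -/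
def Pseudoconvex (n : ℕ) (Ω : Set (Fin n → ℂ)) : Prop :=
  ∃ Φ : (Fin n → ℂ) → ℝ, ContDiffOn ℝ (⊤ : ℕ∞) Φ Ω ∧ (∀ z ∈ Ω, ∀ ξ, 0 ≤ hessC n Φ z ξ) ∧
    ExhaustsOn n Ω Φ

/-- `r` is a smooth defining function for `Ω` which is Levi pseudoconvex. -/
def IsLeviDefiningFn (n : ℕ) (Ω : Set (Fin n → ℂ)) (r : (Fin n → ℂ) → ℝ) : Prop :=
  ContDiff ℝ (⊤ : ℕ∞) r ∧ Ω = {z | r z < 0} ∧ (∀ z, r z = 0 → fderiv ℝ r z ≠ 0) ∧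
    (∀ p, r p = 0 → ∀ ξ, delPair n r p ξ = 0 → 0 ≤ hessC n r p ξ)

/-- The Wirtinger derivative `∂φ/∂z_j`. -/
def delCoord (n : ℕ) (φ : (Fin n → ℂ) → ℂ) (j : Fin n) (z : Fin n → ℂ) : ℂ :=
  (1 / 2) * (fderiv ℝ φ z (Pi.single j 1) - Complex.I * fderiv ℝ φ z (Pi.single j Complex.I))

section Wirtinger

variable {n : ℕ} {f g : (Fin n → ℂ) → ℂ} {z : Fin n → ℂ}

lemma dbarCoord_congr (h : f =ᶠ[nhds z] g) (j : Fin n) :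
    dbarCoord n f j z = dbarCoord n g j z := by
  simp only [dbarCoord, h.fderiv_eq]

lemma dbarCoord_mul (hf : DifferentiableAt ℝ f z) (hg : DifferentiableAt ℝ g z) (j : Fin n) :
    dbarCoord n (fun w => f w * g w) j z
      = dbarCoord n f j z * g z + f z * dbarCoord n g j z := by
  simp only [dbarCoord, fderiv_fun_mul hf hg]
  simp
  ring

lemma delCoord_mul (hf : DifferentiableAt ℝ f z) (hg : DifferentiableAt ℝ g z) (j : Fin n) :
    delCoord n (fun w => f w * g w) j z
      = delCoord n f j z * g z + f z * delCoord n g j z := by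
  simp only [delCoord, fderiv_fun_mul hf hg]
  simp
  ring

lemma dbarCoord_sub (hf : DifferentiableAt ℝ f z) (hg : DifferentiableAt ℝ g z) (j : Fin n) :
    dbarCoord n (fun w => f w - g w) j z = dbarCoord n f j z - dbarCoord n g j z := by
  simp only [dbarCoord, fderiv_fun_sub hf hg]
  simp
  ring

lemma fderiv_conj_apply (f : (Fin n → ℂ) → ℂ) (z v : Fin n → ℂ) :
    fderiv ℝ (fun w => (starRingEnd ℂ) (f w)) z v = (starRingEnd ℂ) (fderiv ℝ f z v) := by
  have h := ContinuousLinearEquiv.comp_fderiv (Complex.conjCLE) (f := f) (x := z)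
  have h2 : (Complex.conjCLE ∘ f) = fun w => (starRingEnd ℂ) (f w) := by
    ext w; simp
  rw [h2] at h
  rw [h]; simp

lemma delCoord_conj (f : (Fin n → ℂ) → ℂ) (j : Fin n) (z : Fin n → ℂ) :
    delCoord n (fun w => (starRingEnd ℂ) (f w)) j z = (starRingEnd ℂ) (dbarCoord n f j z) := by
  simp only [delCoord, dbarCoord, fderiv_conj_apply]
  simp [map_ofNat]
  ring

lemma contDiff_dbarCoord {k m : WithTop ℕ∞} (hf : ContDiff ℝ m f) (hk : k + 1 ≤ m) (j : Fin n) :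
    ContDiff ℝ k (dbarCoord n f j) := by
  have h := hf.fderiv_right hk
  have h1 := h.clm_apply (contDiff_const (c := (Pi.single j 1 : Fin n → ℂ)))
  have h2 := h.clm_apply (contDiff_const (c := (Pi.single j Complex.I : Fin n → ℂ)))
  exact contDiff_const.mul (h1.add (contDiff_const.mul h2))

lemma contDiff_delCoord {k m : WithTop ℕ∞} (hf : ContDiff ℝ m f) (hk : k + 1 ≤ m) (j : Fin n) :
    ContDiff ℝ k (delCoord n f j) := by
  have h := hf.fderiv_right hk
  have h1 := h.clm_apply (contDiff_const (c := (Pi.single j 1 : Fin n → ℂ)))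
  have h2 := h.clm_apply (contDiff_const (c := (Pi.single j Complex.I : Fin n → ℂ)))
  exact contDiff_const.mul (h1.sub (contDiff_const.mul h2))

lemma dbarCoord_eq_zero_of_notMem_tsupport (h : z ∉ tsupport f) (j : Fin n) :
    dbarCoord n f j z = 0 := by
  have : fderiv ℝ f z = 0 := by
    by_contra h0
    exact h (support_fderiv_subset ℝ h0)
  simp [dbarCoord, this]

lemma delCoord_eq_zero_of_notMem_tsupport (h : z ∉ tsupport f) (j : Fin n) :
    delCoord n f j z = 0 := by
  have : fderiv ℝ f z = 0 := by
    by_contra h0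
    exact h (support_fderiv_subset ℝ h0)
  simp [delCoord, this]

lemma hasCompactSupport_dbarCoord (h : HasCompactSupport f) (j : Fin n) :
    HasCompactSupport (dbarCoord n f j) :=
  HasCompactSupport.intro h fun _ hx => dbarCoord_eq_zero_of_notMem_tsupport hx j

lemma hasCompactSupport_delCoord (h : HasCompactSupport f) (j : Fin n) :
    HasCompactSupport (delCoord n f j) :=
  HasCompactSupport.intro h fun _ hx => delCoord_eq_zero_of_notMem_tsupport hx j

lemma integral_fderiv_apply_eq_zero (hf : ContDiff ℝ 1 f) (hc : HasCompactSupport f)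
    (v : Fin n → ℂ) : ∫ z, fderiv ℝ f z v = 0 := by
  have hd : Continuous fun z => fderiv ℝ f z v :=
    (hf.continuous_fderiv one_ne_zero).clm_apply continuous_const
  have hdc : HasCompactSupport fun z => fderiv ℝ f z v :=
    (hc.fderiv_apply ℝ v)
  have h := integral_bilinear_fderiv_right_eq_neg_left_of_integrable
    (μ := (volume : Measure (Fin n → ℂ))) (f := fun _ : Fin n → ℂ => (1 : ℂ)) (g := f) (v := v)
    (B := ContinuousLinearMap.mul ℝ ℂ) (by simp)
    (by simpa using hd.integrable_of_hasCompactSupport hdc)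
    (by simpa using hf.continuous.integrable_of_hasCompactSupport hc)
    (fun _ _ => differentiableAt_const _)
    (fun x _ => hf.differentiable one_ne_zero x)
  simpa using h

lemma integral_dbarCoord_eq_zero (hf : ContDiff ℝ 1 f) (hc : HasCompactSupport f)
    (j : Fin n) : ∫ z, dbarCoord n f j z = 0 := by
  have hd (v : Fin n → ℂ) : Integrable fun z => fderiv ℝ f z v :=
    ((hf.continuous_fderiv one_ne_zero).clm_apply continuous_const).integrable_of_hasCompactSupport
      (hc.fderiv_apply ℝ v)
  simp only [dbarCoord]
  rw [integral_const_mul, integral_add (hd _) ((hd _).const_mul _), integral_const_mul,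
    integral_fderiv_apply_eq_zero hf hc, integral_fderiv_apply_eq_zero hf hc]
  simp

lemma integral_delCoord_eq_zero (hf : ContDiff ℝ 1 f) (hc : HasCompactSupport f)
    (j : Fin n) : ∫ z, delCoord n f j z = 0 := by
  have hd (v : Fin n → ℂ) : Integrable fun z => fderiv ℝ f z v :=
    ((hf.continuous_fderiv one_ne_zero).clm_apply continuous_const).integrable_of_hasCompactSupport
      (hc.fderiv_apply ℝ v)
  simp only [delCoord]
  rw [integral_const_mul, integral_sub (hd _) ((hd _).const_mul _), integral_const_mul,
    integral_fderiv_apply_eq_zero hf hc, integral_fderiv_apply_eq_zero hf hc]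
  simp

/-- Integration by parts for `∂̄_j`. -/
lemma integral_mul_dbarCoord (hf : ContDiff ℝ 1 f) (hg : ContDiff ℝ 1 g)
    (hc : HasCompactSupport g) (j : Fin n) :
    ∫ z, f z * dbarCoord n g j z = - ∫ z, dbarCoord n f j z * g z := by
  have h := integral_dbarCoord_eq_zero (hf.mul hg) hc.mul_left j
  have h2 : ∀ z, dbarCoord n (fun w => f w * g w) j z
      = dbarCoord n f j z * g z + f z * dbarCoord n g j z := fun z =>
    dbarCoord_mul (hf.differentiable one_ne_zero z) (hg.differentiable one_ne_zero z) j
  have cf : Continuous (dbarCoord n f j) := (contDiff_dbarCoord (k := 0) hf (by simp) j).continuous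
  have cg : Continuous (dbarCoord n g j) := (contDiff_dbarCoord (k := 0) hg (by simp) j).continuous
  rw [integral_congr_ae (Filter.Eventually.of_forall h2)] at h
  have i1 : Integrable fun z => dbarCoord n f j z * g z :=
    (cf.mul hg.continuous).integrable_of_hasCompactSupport hc.mul_left
  have i2 : Integrable fun z => f z * dbarCoord n g j z :=
    (hf.continuous.mul cg).integrable_of_hasCompactSupport
      (hasCompactSupport_dbarCoord hc j).mul_left
  rw [integral_add i1 i2] at h
  linear_combination h

lemma fderiv_dbarCoord_apply (hf : ContDiffAt ℝ 2 f z) (j : Fin n) (w : Fin n → ℂ) :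
    fderiv ℝ (dbarCoord n f j) z w = (1 / 2) * (fderiv ℝ (fderiv ℝ f) z w (Pi.single j 1)
      + I * fderiv ℝ (fderiv ℝ f) z w (Pi.single j I)) := by
  have hd : HasFDerivAt (fderiv ℝ f) (fderiv ℝ (fderiv ℝ f) z) z :=
    ((hf.fderiv_right (m := 1) (by norm_num)).differentiableAt one_ne_zero).hasFDerivAt
  have hv (v : Fin n → ℂ) := hd.clm_apply (hasFDerivAt_const v z)
  have h := ((hv (Pi.single j 1)).add ((hv (Pi.single j I)).const_mul I)).const_mul (1 / 2 : ℂ)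
  rw [HasFDerivAt.fderiv (f := dbarCoord n f j) h]
  simp [mul_add]

lemma fderiv_delCoord_apply (hf : ContDiffAt ℝ 2 f z) (j : Fin n) (w : Fin n → ℂ) :
    fderiv ℝ (delCoord n f j) z w = (1 / 2) * (fderiv ℝ (fderiv ℝ f) z w (Pi.single j 1)
      - I * fderiv ℝ (fderiv ℝ f) z w (Pi.single j I)) := by
  have hd : HasFDerivAt (fderiv ℝ f) (fderiv ℝ (fderiv ℝ f) z) z :=
    ((hf.fderiv_right (m := 1) (by norm_num)).differentiableAt one_ne_zero).hasFDerivAt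
  have hv (v : Fin n → ℂ) := hd.clm_apply (hasFDerivAt_const v z)
  have h := ((hv (Pi.single j 1)).sub ((hv (Pi.single j I)).const_mul I)).const_mul (1 / 2 : ℂ)
  rw [HasFDerivAt.fderiv (f := delCoord n f j) h]
  simp

/-- `∂̄_k` and `∂_j` commute on `C²` functions. -/
lemma dbarCoord_delCoord_comm (hf : ContDiffAt ℝ 2 f z) (j k : Fin n) :
    dbarCoord n (delCoord n f j) k z = delCoord n (dbarCoord n f k) j z := by
  have hs : IsSymmSndFDerivAt ℝ f z := hf.isSymmSndFDerivAt (by simp)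
  simp only [dbarCoord.eq_1 n (delCoord n f j), delCoord.eq_1 n (dbarCoord n f k),
    fderiv_dbarCoord_apply hf, fderiv_delCoord_apply hf]
  rw [hs.eq (Pi.single k 1), hs.eq (Pi.single k 1), hs.eq (Pi.single k I), hs.eq (Pi.single k I)]
  ring

/-- `∂̄_k` and `∂̄_j` commute on `C²` functions. -/
lemma dbarCoord_dbarCoord_comm (hf : ContDiffAt ℝ 2 f z) (j k : Fin n) :
    dbarCoord n (dbarCoord n f j) k z = dbarCoord n (dbarCoord n f k) j z := by
  have hs : IsSymmSndFDerivAt ℝ f z := hf.isSymmSndFDerivAt (by simp)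
  simp only [dbarCoord.eq_1 n (dbarCoord n f j), dbarCoord.eq_1 n (dbarCoord n f k),
    fderiv_dbarCoord_apply hf]
  rw [hs.eq (Pi.single k 1), hs.eq (Pi.single k 1), hs.eq (Pi.single k I), hs.eq (Pi.single k I)]
  ring

end Wirtinger

section Hessian

variable {n : ℕ} {W : (Fin n → ℂ) → ℝ} {z : Fin n → ℂ}

lemma contDiffAt_ofReal {k : WithTop ℕ∞} (hW : ContDiffAt ℝ k W z) :
    ContDiffAt ℝ k (fun w => (W w : ℂ)) z :=
  Complex.ofRealCLM.contDiff.contDiffAt.comp z hW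

lemma fderiv_ofReal (hW : DifferentiableAt ℝ W z) :
    fderiv ℝ (fun w => (W w : ℂ)) z = Complex.ofRealCLM.comp (fderiv ℝ W z) :=
  (Complex.ofRealCLM.hasFDerivAt.comp z hW.hasFDerivAt).fderiv

lemma fderiv_fderiv_ofReal_apply (hW : ContDiffAt ℝ 2 W z) (v w : Fin n → ℂ) :
    fderiv ℝ (fderiv ℝ (fun w => (W w : ℂ))) z v w = (fderiv ℝ (fderiv ℝ W) z v w : ℝ) := by
  have h : (fderiv ℝ (fun w => (W w : ℂ)))
      =ᶠ[nhds z] fun y => Complex.ofRealCLM.comp (fderiv ℝ W y) := by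
    filter_upwards [hW.eventually (by simp)] with y hy
    exact fderiv_ofReal (hy.differentiableAt (by simp))
  have hd : HasFDerivAt (fderiv ℝ W) (fderiv ℝ (fderiv ℝ W) z) z :=
    ((hW.fderiv_right (m := 1) (by norm_num)).differentiableAt one_ne_zero).hasFDerivAt
  rw [h.fderiv_eq, ((hasFDerivAt_const Complex.ofRealCLM z).clm_comp hd).fderiv]
  simp

lemma eq_sum_single (ξ : Fin n → ℂ) :
    ξ = ∑ j, ((ξ j).re • (Pi.single j (1 : ℂ) : Fin n → ℂ) +
      (ξ j).im • (Pi.single j I : Fin n → ℂ)) := by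
  ext k
  simp only [Finset.sum_apply, Pi.add_apply, Pi.smul_apply]
  rw [Finset.sum_eq_single k]
  · simp
  · intro b _ hb
    simp [Pi.single_eq_of_ne hb.symm]
  · simp

/-- The complex Hessian is the Hermitian form with coefficients `∂²f/∂z_j∂z̄_k`. -/
lemma hessC_eq_re_sum (hW : ContDiffAt ℝ 2 W z) (ξ : Fin n → ℂ) :
    hessC n W z ξ = ∑ j, ∑ k, (dbarCoord n (delCoord n (fun w => (W w : ℂ)) j) k z
      * ξ j * (starRingEnd ℂ) (ξ k)).re := by
  have hI : I • ξ = ∑ j, ((-(ξ j).im) • (Pi.single j (1 : ℂ) : Fin n → ℂ)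
      + (ξ j).re • (Pi.single j I : Fin n → ℂ)) := by
    rw [eq_sum_single (I • ξ)]
    simp
  have key (b : (Fin n → ℂ) →L[ℝ] (Fin n → ℂ) →L[ℝ] ℝ) (p q : Fin n → ℝ) :
      b (∑ j, (p j • (Pi.single j (1 : ℂ) : Fin n → ℂ) + q j • (Pi.single j I : Fin n → ℂ)))
        (∑ j, (p j • (Pi.single j (1 : ℂ) : Fin n → ℂ) + q j • (Pi.single j I : Fin n → ℂ)))
      = ∑ j, ∑ k, (p k * p j * b (Pi.single k 1) (Pi.single j 1)
        + p k * q j * b (Pi.single k 1) (Pi.single j I)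
        + q k * p j * b (Pi.single k I) (Pi.single j 1)
        + q k * q j * b (Pi.single k I) (Pi.single j I)) := by
    simp only [map_sum, map_add, map_smul, _root_.sum_apply,
      _root_.add_apply, _root_.smul_apply, smul_eq_mul]
    refine Finset.sum_congr rfl fun j _ => ?_
    rw [Finset.mul_sum, Finset.mul_sum, ← Finset.sum_add_distrib]
    refine Finset.sum_congr rfl fun k _ => ?_
    ring
  simp only [hessC, iteratedFDeriv_two_apply]
  simp only [Matrix.cons_val_zero, Matrix.cons_val_one]
  have k1 := key (fderiv ℝ (fderiv ℝ W) z) (fun j => (ξ j).re) (fun j => (ξ j).im)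
  rw [← eq_sum_single ξ] at k1
  rw [hI, k1, key, ← Finset.sum_add_distrib, Finset.mul_sum]
  refine Finset.sum_congr rfl fun j _ => ?_
  rw [← Finset.sum_add_distrib, Finset.mul_sum]
  refine Finset.sum_congr rfl fun k _ => ?_
  rw [dbarCoord, fderiv_delCoord_apply (contDiffAt_ofReal hW),
    fderiv_delCoord_apply (contDiffAt_ofReal hW)]
  simp only [fderiv_fderiv_ofReal_apply hW]
  generalize fderiv ℝ (fderiv ℝ W) z (Pi.single k 1) (Pi.single j 1) = a
  generalize fderiv ℝ (fderiv ℝ W) z (Pi.single k 1) (Pi.single j I) = b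
  generalize fderiv ℝ (fderiv ℝ W) z (Pi.single k I) (Pi.single j 1) = c
  generalize fderiv ℝ (fderiv ℝ W) z (Pi.single k I) (Pi.single j I) = d
  have : (1 / 2 : ℂ) * (1 / 2 * (↑a - I * ↑b) + I * (1 / 2 * (↑c - I * ↑d))) * ξ j
      * (starRingEnd ℂ) (ξ k)
    = (((1 / 4 : ℝ) : ℂ)) * ((((a + d : ℝ) : ℂ) + ((c - b : ℝ) : ℂ) * I)
      * (ξ j * (starRingEnd ℂ) (ξ k))) := by
    push_cast
    ring_nf
    rw [I_sq]
    ring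
  rw [this, Complex.re_ofReal_mul]
  simp
  ring

end Hessian

section BasicEstimate

variable {n : ℕ} {W : (Fin n → ℂ) → ℝ}

/-- The formal adjoint of `-∂̄_j` with respect to the weight `e^{-W}`. -/
def weightedDel (n : ℕ) (W : (Fin n → ℂ) → ℝ) (f : (Fin n → ℂ) → ℂ) (j : Fin n)
    (z : Fin n → ℂ) : ℂ :=
  delCoord n f j z - delCoord n (fun w => (W w : ℂ)) j z * f z

lemma delCoord_cexp_neg {z : Fin n → ℂ} (hW : DifferentiableAt ℝ W z) (j : Fin n) :
    delCoord n (fun w => cexp (-(W w : ℂ))) j z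
      = -(delCoord n (fun w => (W w : ℂ)) j z) * cexp (-(W z : ℂ)) := by
  have h : HasFDerivAt (fun w => (W w : ℂ)) (Complex.ofRealCLM.comp (fderiv ℝ W z)) z :=
    Complex.ofRealCLM.hasFDerivAt.comp z hW.hasFDerivAt
  simp only [delCoord, h.fderiv, h.fun_neg.cexp.fderiv]
  simp
  ring

lemma contDiff_cexp_neg {k : WithTop ℕ∞} (hW : ContDiff ℝ k W) :
    ContDiff ℝ k (fun w => cexp (-(W w : ℂ))) :=
  ((Complex.ofRealCLM.contDiff.comp hW).neg).cexp

lemma contDiff_weightedDel {f : (Fin n → ℂ) → ℂ} (hW : ContDiff ℝ 2 W) (hf : ContDiff ℝ 2 f)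
    (j : Fin n) : ContDiff ℝ 1 (weightedDel n W f j) :=
  (contDiff_delCoord hf (by norm_num) j).sub ((contDiff_delCoord
    (Complex.ofRealCLM.contDiff.comp hW) (by norm_num) j).mul (hf.of_le (by norm_num)))

lemma hasCompactSupport_weightedDel {f : (Fin n → ℂ) → ℂ} (hf : HasCompactSupport f)
    (j : Fin n) : HasCompactSupport (weightedDel n W f j) :=
  (hasCompactSupport_delCoord hf j).sub hf.mul_left

/-- Weighted integration by parts. -/
lemma integral_weightedDel_mul {u v : (Fin n → ℂ) → ℂ} (hW : ContDiff ℝ 1 W)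
    (hu : ContDiff ℝ 1 u) (hv : ContDiff ℝ 1 v) (huc : HasCompactSupport u) (j : Fin n) :
    ∫ z, weightedDel n W u j z * (starRingEnd ℂ) (v z) * cexp (-(W z : ℂ))
      = -∫ z, u z * (starRingEnd ℂ) (dbarCoord n v j z) * cexp (-(W z : ℂ)) := by
  have hE := contDiff_cexp_neg hW
  have hWc : ContDiff ℝ 1 (fun w => (W w : ℂ)) := Complex.ofRealCLM.contDiff.comp hW
  have hvc : ContDiff ℝ 1 (fun z => (starRingEnd ℂ) (v z)) := Complex.conjCLE.contDiff.comp hv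
  have hvE : ContDiff ℝ 1 (fun z => (starRingEnd ℂ) (v z) * cexp (-(W z : ℂ))) := hvc.mul hE
  have h := integral_delCoord_eq_zero (f := fun z => u z * ((starRingEnd ℂ) (v z)
    * cexp (-(W z : ℂ)))) (hu.mul hvE) huc.mul_right j
  have h2 : ∀ z, delCoord n (fun z => u z * ((starRingEnd ℂ) (v z) * cexp (-(W z : ℂ)))) j z
      = weightedDel n W u j z * (starRingEnd ℂ) (v z) * cexp (-(W z : ℂ))
        + u z * (starRingEnd ℂ) (dbarCoord n v j z) * cexp (-(W z : ℂ)) := fun z => by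
    rw [delCoord_mul (hu.differentiable one_ne_zero z) (hvE.differentiable one_ne_zero z),
      delCoord_mul (hvc.differentiable one_ne_zero z) (hE.differentiable one_ne_zero z),
      delCoord_conj, delCoord_cexp_neg (hW.differentiable one_ne_zero z), weightedDel]
    ring
  rw [integral_congr_ae (Filter.Eventually.of_forall h2)] at h
  have c1 : Continuous (weightedDel n W u j) :=
    (contDiff_delCoord (k := 0) hu (by simp) j).continuous.sub
      ((contDiff_delCoord (k := 0) hWc (by simp) j).continuous.mul hu.continuous)
  have c2 : Continuous (fun z => (starRingEnd ℂ) (dbarCoord n v j z)) :=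
    Complex.continuous_conj.comp (contDiff_dbarCoord (k := 0) hv (by simp) j).continuous
  have i1 : Integrable fun z =>
      weightedDel n W u j z * (starRingEnd ℂ) (v z) * cexp (-(W z : ℂ)) :=
    ((c1.mul hvc.continuous).mul hE.continuous).integrable_of_hasCompactSupport
      (hasCompactSupport_weightedDel huc j).mul_right.mul_right
  have i2 : Integrable fun z =>
      u z * (starRingEnd ℂ) (dbarCoord n v j z) * cexp (-(W z : ℂ)) :=
    ((hu.continuous.mul c2).mul hE.continuous).integrable_of_hasCompactSupport
      huc.mul_right.mul_right
  rw [integral_add i1 i2] at h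
  linear_combination h

/-- The commutation identity behind the Morrey–Kohn–Hörmander formula. -/
lemma integral_weightedDel_mul_weightedDel {f g : (Fin n → ℂ) → ℂ} (hW : ContDiff ℝ 2 W)
    (hf : ContDiff ℝ 2 f) (hg : ContDiff ℝ 2 g) (hfc : HasCompactSupport f)
    (hgc : HasCompactSupport g) (j k : Fin n) :
    ∫ z, weightedDel n W g k z * (starRingEnd ℂ) (weightedDel n W f j z) * cexp (-(W z : ℂ))
      = (∫ z, dbarCoord n g j z * (starRingEnd ℂ) (dbarCoord n f k z) * cexp (-(W z : ℂ)))
        + ∫ z, g z * (starRingEnd ℂ) (dbarCoord n (delCoord n (fun w => (W w : ℂ)) j) k z * f z)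
          * cexp (-(W z : ℂ)) := by
  have hW1 : ContDiff ℝ 1 W := hW.of_le (by norm_num)
  have hWc : ContDiff ℝ 2 (fun w => (W w : ℂ)) := Complex.ofRealCLM.contDiff.comp hW
  have hE := contDiff_cexp_neg hW1
  have hf1 : ContDiff ℝ 1 f := hf.of_le (by norm_num)
  have hg1 : ContDiff ℝ 1 g := hg.of_le (by norm_num)
  have hbf : ContDiff ℝ 1 (dbarCoord n f k) := contDiff_dbarCoord hf (by norm_num) k
  have hlf : ContDiff ℝ 1 (delCoord n f j) := contDiff_delCoord hf (by norm_num) j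
  have hlW : ContDiff ℝ 1 (delCoord n (fun w => (W w : ℂ)) j) :=
    contDiff_delCoord hWc (by norm_num) j
  rw [integral_weightedDel_mul hW1 hg1 (contDiff_weightedDel hW hf j) hgc]
  have e1 : ∀ z, dbarCoord n (weightedDel n W f j) k z
      = weightedDel n W (dbarCoord n f k) j z
        - dbarCoord n (delCoord n (fun w => (W w : ℂ)) j) k z * f z := fun z => by
    have : weightedDel n W f j
        = fun z => delCoord n f j z - delCoord n (fun w => (W w : ℂ)) j z * f z := rfl
    rw [this, dbarCoord_sub (hlf.differentiable one_ne_zero z)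
      ((hlW.mul hf1).differentiable one_ne_zero z),
      dbarCoord_mul (hlW.differentiable one_ne_zero z) (hf1.differentiable one_ne_zero z),
      dbarCoord_delCoord_comm hf.contDiffAt, weightedDel]
    ring
  have h := congrArg (starRingEnd ℂ)
    (integral_weightedDel_mul hW1 hbf hg1 (hasCompactSupport_dbarCoord hfc k) j)
  rw [map_neg, ← integral_conj, ← integral_conj] at h
  simp only [map_mul, Complex.conj_conj, ← Complex.exp_conj, map_neg, Complex.conj_ofReal] at h
  have c1 : Continuous (fun z => (starRingEnd ℂ) (weightedDel n W (dbarCoord n f k) j z)) :=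
    Complex.continuous_conj.comp ((contDiff_delCoord (k := 0) hbf (by simp) j).continuous.sub
      (hlW.continuous.mul hbf.continuous))
  have c2 : Continuous (fun z =>
      (starRingEnd ℂ) (dbarCoord n (delCoord n (fun w => (W w : ℂ)) j) k z * f z)) :=
    Complex.continuous_conj.comp
      ((contDiff_dbarCoord (k := 0) hlW (by simp) k).continuous.mul hf.continuous)
  have i1 : Integrable fun z => g z * (starRingEnd ℂ) (weightedDel n W (dbarCoord n f k) j z)
      * cexp (-(W z : ℂ)) :=
    ((hg.continuous.mul c1).mul hE.continuous).integrable_of_hasCompactSupport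
      hgc.mul_right.mul_right
  have i2 : Integrable fun z => g z *
      (starRingEnd ℂ) (dbarCoord n (delCoord n (fun w => (W w : ℂ)) j) k z * f z)
      * cexp (-(W z : ℂ)) :=
    ((hg.continuous.mul c2).mul hE.continuous).integrable_of_hasCompactSupport
      hgc.mul_right.mul_right
  have e2 : ∫ z, g z * (starRingEnd ℂ) (dbarCoord n (weightedDel n W f j) k z) * cexp (-(W z : ℂ))
      = (∫ z, g z * (starRingEnd ℂ) (weightedDel n W (dbarCoord n f k) j z) * cexp (-(W z : ℂ)))
        - ∫ z, g z * (starRingEnd ℂ) (dbarCoord n (delCoord n (fun w => (W w : ℂ)) j) k z * f z)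
          * cexp (-(W z : ℂ)) := by
    rw [← integral_sub i1 i2]
    refine integral_congr_ae (Filter.Eventually.of_forall fun z => ?_)
    simp only [e1, map_sub]
    ring
  have e3 : ∫ z, g z * (starRingEnd ℂ) (weightedDel n W (dbarCoord n f k) j z) * cexp (-(W z : ℂ))
      = -∫ z, dbarCoord n g j z * (starRingEnd ℂ) (dbarCoord n f k z) * cexp (-(W z : ℂ)) := by
    simp only [mul_comm (g _), mul_comm (dbarCoord n g j _)]
    exact h
  rw [e2, e3]
  ring

/-- The Morrey–Kohn–Hörmander estimate for compactly supported forms. -/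
theorem morrey_kohn_hormander {F : Fin n → (Fin n → ℂ) → ℂ} (hW : ContDiff ℝ 2 W)
    (hF : ∀ j, ContDiff ℝ 2 (F j)) (hFc : ∀ j, HasCompactSupport (F j)) :
    ∫ z, hessC n W z (fun j => F j z) * Real.exp (-W z)
      ≤ (∫ z, ‖∑ j, weightedDel n W (F j) j z‖ ^ 2 * Real.exp (-W z))
        + (1 / 2) * ∫ z, (∑ j, ∑ k, ‖dbarCoord n (F j) k z - dbarCoord n (F k) j z‖ ^ 2)
          * Real.exp (-W z) := by
  have hWc : ContDiff ℝ 2 (fun w => (W w : ℂ)) := Complex.ofRealCLM.contDiff.comp hW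
  have hE : Continuous (fun w => cexp (-(W w : ℂ))) := (contDiff_cexp_neg hW).continuous
  have hEr : Continuous (fun w => Real.exp (-W w)) := Real.continuous_exp.comp hW.continuous.neg
  have hδ (j : Fin n) : Continuous (weightedDel n W (F j) j) :=
    (contDiff_weightedDel hW (hF j) j).continuous
  have hb (j k : Fin n) : Continuous (dbarCoord n (F j) k) :=
    (contDiff_dbarCoord (k := 0) (hF j) (by norm_num) k).continuous
  have hWW (j k : Fin n) : Continuous (dbarCoord n (delCoord n (fun w => (W w : ℂ)) j) k) :=
    (contDiff_dbarCoord (k := 0) (contDiff_delCoord (k := 1) hWc (by norm_num) j)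
      (by norm_num) k).continuous
  have i1 (j k : Fin n) : Integrable fun z => weightedDel n W (F k) k z
      * (starRingEnd ℂ) (weightedDel n W (F j) j z) * cexp (-(W z : ℂ)) :=
    (((hδ k).mul (Complex.continuous_conj.comp (hδ j))).mul hE).integrable_of_hasCompactSupport
      (hasCompactSupport_weightedDel (hFc k) k).mul_right.mul_right
  have i2 (j k : Fin n) : Integrable fun z => dbarCoord n (F k) j z
      * (starRingEnd ℂ) (dbarCoord n (F j) k z) * cexp (-(W z : ℂ)) :=
    (((hb k j).mul (Complex.continuous_conj.comp (hb j k))).mul hE).integrable_of_hasCompactSupport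
      (hasCompactSupport_dbarCoord (hFc k) j).mul_right.mul_right
  have i3 (j k : Fin n) : Integrable fun z => F k z
      * (starRingEnd ℂ) (dbarCoord n (delCoord n (fun w => (W w : ℂ)) j) k z * F j z)
      * cexp (-(W z : ℂ)) :=
    (((hF k).continuous.mul (Complex.continuous_conj.comp
      ((hWW j k).mul (hF j).continuous))).mul hE).integrable_of_hasCompactSupport
      (hFc k).mul_right.mul_right
  have hsum := Finset.sum_congr (rfl : (Finset.univ : Finset (Fin n)) = Finset.univ)
    fun j _ => Finset.sum_congr (rfl : (Finset.univ : Finset (Fin n)) = Finset.univ)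
    fun k _ => integral_weightedDel_mul_weightedDel hW (hF j) (hF k) (hFc j) (hFc k) j k
  simp only [Finset.sum_add_distrib] at hsum
  simp only [← integral_finsetSum _ fun k _ => i1 _ k,
    ← integral_finsetSum _ fun k _ => i2 _ k, ← integral_finsetSum _ fun k _ => i3 _ k] at hsum
  rw [← integral_finsetSum _ fun j _ => integrable_finsetSum _ fun k _ => i1 j k,
    ← integral_finsetSum _ fun j _ => integrable_finsetSum _ fun k _ => i2 j k,
    ← integral_finsetSum _ fun j _ => integrable_finsetSum _ fun k _ => i3 j k] at hsum
  replace hsum := congrArg Complex.re hsum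
  rw [Complex.add_re] at hsum
  have hre {f : (Fin n → ℂ) → ℂ} (hf : Integrable f) : (∫ z, f z).re = ∫ z, (f z).re :=
    (integral_re hf).symm
  rw [hre (integrable_finsetSum _ fun j _ => integrable_finsetSum _ fun k _ => i1 j k),
    hre (integrable_finsetSum _ fun j _ => integrable_finsetSum _ fun k _ => i2 j k),
    hre (integrable_finsetSum _ fun j _ => integrable_finsetSum _ fun k _ => i3 j k)] at hsum
  have hexp (z : Fin n → ℂ) : cexp (-(W z : ℂ)) = ((Real.exp (-W z) : ℝ) : ℂ) := by
    push_cast; rfl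
  have e1 (z : Fin n → ℂ) : (∑ j, ∑ k, weightedDel n W (F k) k z
      * (starRingEnd ℂ) (weightedDel n W (F j) j z) * cexp (-(W z : ℂ))).re
      = ‖∑ j, weightedDel n W (F j) j z‖ ^ 2 * Real.exp (-W z) := by
    simp only [← Finset.sum_mul, ← Finset.mul_sum]
    rw [← map_sum, Complex.mul_conj, hexp, Complex.normSq_eq_norm_sq, ← Complex.ofReal_mul,
      Complex.ofReal_re]
  have e3 (z : Fin n → ℂ) : (∑ j, ∑ k, F k z
      * (starRingEnd ℂ) (dbarCoord n (delCoord n (fun w => (W w : ℂ)) j) k z * F j z)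
      * cexp (-(W z : ℂ))).re = hessC n W z (fun j => F j z) * Real.exp (-W z) := by
    rw [hessC_eq_re_sum hW.contDiffAt, Finset.sum_mul, Complex.re_sum]
    refine Finset.sum_congr rfl fun j _ => ?_
    rw [Finset.sum_mul, Complex.re_sum]
    refine Finset.sum_congr rfl fun k _ => ?_
    rw [hexp, Complex.re_mul_ofReal, ← Complex.conj_re (_ * _)]
    simp only [map_mul, Complex.conj_conj]
    ring_nf
  have e2 (z : Fin n → ℂ) : -((1 / 2) * ((∑ j, ∑ k,
      ‖dbarCoord n (F j) k z - dbarCoord n (F k) j z‖ ^ 2) * Real.exp (-W z)))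
      ≤ (∑ j, ∑ k, dbarCoord n (F k) j z
      * (starRingEnd ℂ) (dbarCoord n (F j) k z) * cexp (-(W z : ℂ))).re := by
    simp only [Complex.re_sum, hexp, Complex.re_mul_ofReal]
    simp only [← Finset.sum_mul]
    rw [← mul_assoc, ← neg_mul]
    refine mul_le_mul_of_nonneg_right ?_ (Real.exp_pos _).le
    have h1 (j k : Fin n) : ‖dbarCoord n (F j) k z - dbarCoord n (F k) j z‖ ^ 2
        = ‖dbarCoord n (F j) k z‖ ^ 2 + ‖dbarCoord n (F k) j z‖ ^ 2
          - 2 * (dbarCoord n (F k) j z * (starRingEnd ℂ) (dbarCoord n (F j) k z)).re := by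
      simp only [← Complex.normSq_eq_norm_sq, Complex.normSq_sub]
      rw [← Complex.conj_re (_ * _)]
      simp only [map_mul, Complex.conj_conj]
      ring_nf
    simp only [h1, Finset.sum_sub_distrib, Finset.sum_add_distrib, ← Finset.mul_sum]
    have p1 : 0 ≤ ∑ j, ∑ k, ‖dbarCoord n (F j) k z‖ ^ 2 := by positivity
    have p2 : 0 ≤ ∑ j, ∑ k, ‖dbarCoord n (F k) j z‖ ^ 2 := by positivity
    linarith
  simp only [e1, e3] at hsum
  have i4 : Integrable fun z => (∑ j, ∑ k,
      ‖dbarCoord n (F j) k z - dbarCoord n (F k) j z‖ ^ 2) * Real.exp (-W z) := by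
    simp only [Finset.sum_mul]
    refine integrable_finsetSum _ fun j _ => integrable_finsetSum _ fun k _ => ?_
    refine Continuous.integrable_of_hasCompactSupport
      ((((hb j k).sub (hb k j)).norm.pow 2).mul hEr) (HasCompactSupport.mul_right ?_)
    have := ((hasCompactSupport_dbarCoord (hFc j) k).sub (hasCompactSupport_dbarCoord (hFc k) j))
    exact this.comp_left (g := fun x : ℂ => ‖x‖ ^ 2) (by simp)
  have h2 := integral_mono (i4.const_mul (1 / 2)).neg
    (integrable_finsetSum _ fun j _ => integrable_finsetSum _ fun k _ => i2 j k).re e2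
  rw [integral_neg', integral_const_mul] at h2
  change _ ≤ ∫ z, (∑ j, ∑ k, dbarCoord n (F k) j z
      * (starRingEnd ℂ) (dbarCoord n (F j) k z) * cexp (-(W z : ℂ))).re at h2
  linarith

end BasicEstimate

section Mollification

open Filter Topology ContinuousLinearMap
open scoped Convolution ENNReal

variable {V : Type*} [NormedAddCommGroup V] [NormedSpace ℝ V] [FiniteDimensional ℝ V]
  [MeasurableSpace V] [BorelSpace V] {μ : Measure V} [μ.IsAddHaarMeasure]

/-- Convolution of a complex-valued function with a normalized bump function. -/
def mollify (μ : Measure V) (ρ : ContDiffBump (0 : V)) (f : V → ℂ) : V → ℂ :=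
  ρ.normed μ ⋆[lsmul ℝ ℝ, μ] f

lemma mollify_apply (ρ : ContDiffBump (0 : V)) (f : V → ℂ) (x : V) :
    mollify μ ρ f x = ∫ y, ((ρ.normed μ (x - y) : ℝ) : ℂ) * f y ∂μ := by
  rw [mollify, convolution_lsmul_swap]
  simp

lemma convolutionExists_normed (ρ : ContDiffBump (0 : V)) {f : V → ℂ}
    (hf : LocallyIntegrable f μ) : ConvolutionExists (ρ.normed μ) f (lsmul ℝ ℝ) μ :=
  ρ.hasCompactSupport_normed.convolutionExists_left _ ρ.continuous_normed hf

lemma contDiff_mollify (ρ : ContDiffBump (0 : V)) {f : V → ℂ} (hf : LocallyIntegrable f μ) :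
    ContDiff ℝ (⊤ : ℕ∞) (mollify μ ρ f) :=
  ρ.hasCompactSupport_normed.contDiff_convolution_left _ ρ.contDiff_normed hf

lemma tsupport_mollify_subset (ρ : ContDiffBump (0 : V)) (f : V → ℂ) :
    tsupport (mollify μ ρ f) ⊆ cthickening ρ.rOut (tsupport f) := by
  refine closure_minimal ?_ isClosed_cthickening
  refine (support_convolution_subset_swap (lsmul ℝ ℝ)).trans ?_
  rintro _ ⟨a, ha, b, hb, rfl⟩
  refine mem_cthickening_of_dist_le _ a _ _ (subset_tsupport _ ha) ?_
  rw [ρ.support_normed_eq] at hb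
  simpa [dist_eq_norm] using (mem_ball_zero_iff.1 hb).le

lemma mollify_sub (ρ : ContDiffBump (0 : V)) {f g : V → ℂ}
    (hf : LocallyIntegrable f μ) (hg : LocallyIntegrable g μ) :
    mollify μ ρ (f - g) = mollify μ ρ f - mollify μ ρ g := by
  have h := (convolutionExists_normed ρ hf).distrib_add (convolutionExists_normed ρ hg.neg)
  rw [sub_eq_add_neg, mollify, h, sub_eq_add_neg]
  congr 1
  ext x
  simp [mollify, convolution, integral_neg]

lemma eLpNorm_mollify_le (ρ : ContDiffBump (0 : V)) {f : V → ℂ}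
    (hf : AEStronglyMeasurable f μ) :
    eLpNorm (mollify μ ρ f) 2 μ ≤ eLpNorm f 2 μ := by
  set r : V → ℝ≥0∞ := fun x => ENNReal.ofReal (ρ.normed μ x) with hr
  have hrm : Measurable r := (ρ.continuous_normed (μ := μ)).measurable.ennreal_ofReal
  have hr1 : ∫⁻ x, r x ∂μ = 1 := by
    rw [hr, ← ofReal_integral_eq_lintegral_ofReal ρ.integrable_normed
      (Eventually.of_forall ρ.nonneg_normed), ρ.integral_normed, ENNReal.ofReal_one]
  have hfm : AEMeasurable (fun y => ‖f y‖ₑ) μ := hf.enorm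
  have hpt : ∀ x, ‖mollify μ ρ f x‖ₑ ^ (2 : ℝ) ≤ ∫⁻ y, r (x - y) * ‖f y‖ₑ ^ (2 : ℝ) ∂μ := by
    intro x
    have hrx : Measurable fun y => r (x - y) := hrm.comp (measurable_const.sub measurable_id)
    have hrx1 : ∫⁻ y, r (x - y) ∂μ = 1 := by
      rw [lintegral_sub_left_eq_self r x, hr1]
    have h1 : ‖mollify μ ρ f x‖ₑ ≤ ∫⁻ y, r (x - y) ^ (1 / 2 : ℝ) *
        (r (x - y) ^ (1 / 2 : ℝ) * ‖f y‖ₑ) ∂μ := by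
      rw [mollify_apply]
      refine (enorm_integral_le_lintegral_enorm _).trans (le_of_eq ?_)
      refine lintegral_congr fun y => ?_
      rw [← mul_assoc, ← ENNReal.rpow_add_of_nonneg _ _ (by norm_num) (by norm_num), enorm_mul]
      norm_num [hr]
      congr 1
      rw [← ofReal_norm, Complex.norm_real, Real.norm_of_nonneg (ρ.nonneg_normed _)]
    have h2 := ENNReal.lintegral_mul_le_Lp_mul_Lq μ Real.HolderConjugate.two_two
      (f := fun y => r (x - y) ^ (1 / 2 : ℝ)) (g := fun y => r (x - y) ^ (1 / 2 : ℝ) * ‖f y‖ₑ)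
      (hrx.pow_const _).aemeasurable ((hrx.pow_const _).aemeasurable.mul hfm)
    have h3 : ∀ a : ℝ≥0∞, (a ^ (1 / 2 : ℝ)) ^ (2 : ℝ) = a := fun a => by
      rw [← ENNReal.rpow_mul]; norm_num
    simp only [ENNReal.mul_rpow_of_nonneg _ _ (show (0 : ℝ) ≤ 2 by norm_num), h3] at h2
    have h4 : ‖mollify μ ρ f x‖ₑ ≤
        (∫⁻ y, r (x - y) * ‖f y‖ₑ ^ (2 : ℝ) ∂μ) ^ (1 / 2 : ℝ) := by
      refine h1.trans (h2.trans (le_of_eq ?_))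
      rw [hrx1]; simp
    calc _ ≤ _ := ENNReal.rpow_le_rpow h4 (by norm_num)
      _ = _ := h3 _
  rw [eLpNorm_eq_lintegral_rpow_enorm_toReal (by norm_num) (by norm_num),
    eLpNorm_eq_lintegral_rpow_enorm_toReal (by norm_num) (by norm_num)]
  simp only [ENNReal.toReal_ofNat]
  refine ENNReal.rpow_le_rpow ?_ (by norm_num)
  calc ∫⁻ x, ‖mollify μ ρ f x‖ₑ ^ (2 : ℝ) ∂μ
      ≤ ∫⁻ x, ∫⁻ y, r (x - y) * ‖f y‖ₑ ^ (2 : ℝ) ∂μ ∂μ := lintegral_mono hpt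
    _ = ∫⁻ y, ∫⁻ x, r (x - y) * ‖f y‖ₑ ^ (2 : ℝ) ∂μ ∂μ := by
        apply lintegral_lintegral_swap
        exact (hrm.comp (measurable_fst.sub measurable_snd)).aemeasurable.mul
          ((hfm.pow_const _).comp_snd)
    _ = ∫⁻ y, ‖f y‖ₑ ^ (2 : ℝ) ∂μ := by
        refine lintegral_congr fun y => ?_
        have hry : Measurable fun x => r (x - y) := hrm.comp (measurable_id.sub measurable_const)
        rw [lintegral_mul_const _ hry,
          lintegral_sub_right_eq_self r y, hr1, one_mul]

lemma tendsto_eLpNorm_mollify_sub_of_continuous {g : V → ℂ} (hg : Continuous g)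
    (hgc : HasCompactSupport g) {ρ : ℕ → ContDiffBump (0 : V)}
    (hρ : Tendsto (fun i => (ρ i).rOut) atTop (𝓝 0)) :
    Tendsto (fun i => eLpNorm (mollify μ (ρ i) g - g) 2 μ) atTop (𝓝 0) := by
  set K := cthickening 1 (tsupport g) with hK
  have hKc : IsCompact K := hgc.isCompact.cthickening
  rw [ENNReal.tendsto_atTop_zero]
  intro ε hε
  set c := μ K ^ (1 / 2 : ℝ) with hc
  have hct : c ≠ ⊤ := ENNReal.rpow_ne_top_of_nonneg (by norm_num) hKc.measure_lt_top.ne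
  obtain ⟨δ, hδ, hδc⟩ : ∃ δ : ℝ, 0 < δ ∧ c * ENNReal.ofReal δ ≤ ε := by
    have : Tendsto (fun δ : ℝ => c * ENNReal.ofReal δ) (𝓝[>] 0) (𝓝 0) := by
      have h0 : Tendsto (fun δ : ℝ => ENNReal.ofReal δ) (𝓝[>] 0) (𝓝 0) := by
        simpa using (ENNReal.continuous_ofReal.tendsto 0).mono_left nhdsWithin_le_nhds
      simpa using ENNReal.Tendsto.const_mul h0 (Or.inr hct)
    obtain ⟨δ, h1, h2⟩ := ((this.eventually (ge_mem_nhds hε)).and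
      self_mem_nhdsWithin).exists
    exact ⟨δ, h2, h1⟩
  obtain ⟨d, hd, hdg⟩ := Metric.uniformContinuous_iff.1
    (hgc.uniformContinuous_of_continuous hg) δ hδ
  obtain ⟨N, hN⟩ := eventually_atTop.1 (hρ.eventually
    (gt_mem_nhds (show (0 : ℝ) < min d 1 by positivity)))
  refine ⟨N, fun i hi => ?_⟩
  have hlt := hN i hi
  have hsupp : ∀ x ∉ K, (mollify μ (ρ i) g - g) x = 0 := by
    intro x hx
    have h1 : x ∉ tsupport (mollify μ (ρ i) g) := fun h => hx
      (cthickening_mono (hlt.le.trans (min_le_right _ _)) _ (tsupport_mollify_subset _ _ h))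
    have h2 : x ∉ tsupport g := fun h => hx (self_subset_cthickening _ h)
    simp [image_eq_zero_of_notMem_tsupport h1, image_eq_zero_of_notMem_tsupport h2]
  have hind : mollify μ (ρ i) g - g = K.indicator (mollify μ (ρ i) g - g) := by
    ext x
    by_cases hx : x ∈ K
    · simp [hx]
    · rw [indicator_of_notMem hx, hsupp x hx]
  rw [hind, eLpNorm_indicator_eq_eLpNorm_restrict hKc.measurableSet]
  refine (eLpNorm_le_of_ae_bound (C := δ) (Eventually.of_forall fun x => ?_)).trans ?_
  · rw [Pi.sub_apply, ← dist_eq_norm]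
    refine ContDiffBump.dist_normed_convolution_le hg.aestronglyMeasurable fun y hy => ?_
    exact (hdg (lt_of_lt_of_le (mem_ball.1 hy) (hlt.le.trans (min_le_left _ _)))).le
  · simpa [hc] using hδc

/-- Mollification converges in `L²`. -/
lemma tendsto_eLpNorm_mollify_sub {f : V → ℂ} (hf : MemLp f 2 μ)
    {ρ : ℕ → ContDiffBump (0 : V)} (hρ : Tendsto (fun i => (ρ i).rOut) atTop (𝓝 0)) :
    Tendsto (fun i => eLpNorm (mollify μ (ρ i) f - f) 2 μ) atTop (𝓝 0) := by
  rw [ENNReal.tendsto_atTop_zero]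
  intro ε hε
  have hε3 : ε / 3 ≠ 0 := by simp [hε.ne']
  obtain ⟨g, hgc, hfg, hg, hgm⟩ := hf.exists_hasCompactSupport_eLpNorm_sub_le (by norm_num) hε3
  obtain ⟨N, hN⟩ := ENNReal.tendsto_atTop_zero.1
    (tendsto_eLpNorm_mollify_sub_of_continuous (μ := μ) hg hgc hρ) (ε / 3) (pos_iff_ne_zero.2 hε3)
  refine ⟨N, fun i hi => ?_⟩
  have hfl : LocallyIntegrable f μ := hf.locallyIntegrable (by norm_num)
  have hgl : LocallyIntegrable g μ := hgm.locallyIntegrable (by norm_num)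
  have hdec : mollify μ (ρ i) f - f =
      mollify μ (ρ i) (f - g) + ((mollify μ (ρ i) g - g) + (g - f)) := by
    rw [mollify_sub _ hfl hgl]; abel
  have m1 : AEStronglyMeasurable (mollify μ (ρ i) (f - g)) μ :=
    (contDiff_mollify _ (hfl.sub hgl)).continuous.aestronglyMeasurable
  have m2 : AEStronglyMeasurable (mollify μ (ρ i) g - g) μ :=
    (contDiff_mollify _ hgl).continuous.aestronglyMeasurable.sub hg.aestronglyMeasurable
  have m3 : AEStronglyMeasurable (g - f) μ := hgm.1.sub hf.1
  rw [hdec]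
  calc _ ≤ _ := eLpNorm_add_le m1 (m2.add m3) (by norm_num)
    _ ≤ _ := add_le_add_right (eLpNorm_add_le m2 m3 (by norm_num)) _
    _ ≤ ε / 3 + (ε / 3 + ε / 3) := by
        gcongr
        · exact (eLpNorm_mollify_le _ (hf.1.sub hgm.1)).trans hfg
        · exact hN i hi
        · rwa [eLpNorm_sub_comm]
    _ = ε := by rw [← add_assoc, ENNReal.add_thirds]

end Mollification

section TendstoL2

open Filter Topology
open scoped ENNReal

variable {X : Type*} [MeasurableSpace X] {μ : Measure X}

/-- Convergence in `L²` of a sequence of complex functions. -/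
structure TendstoL2 (μ : Measure X) (F : ℕ → X → ℂ) (f : X → ℂ) : Prop where
  memLp : ∀ i, MemLp (F i) 2 μ
  memLp_lim : MemLp f 2 μ
  tendsto : Tendsto (fun i => eLpNorm (F i - f) 2 μ) atTop (𝓝 0)

lemma TendstoL2.add {F G : ℕ → X → ℂ} {f g : X → ℂ} (hF : TendstoL2 μ F f)
    (hG : TendstoL2 μ G g) : TendstoL2 μ (fun i x => F i x + G i x) (fun x => f x + g x) where
  memLp i := (hF.memLp i).add (hG.memLp i)
  memLp_lim := hF.memLp_lim.add hG.memLp_lim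
  tendsto := by
    have h0 := hF.tendsto.add hG.tendsto
    rw [add_zero] at h0
    refine tendsto_of_tendsto_of_tendsto_of_le_of_le tendsto_const_nhds h0
      (fun _ => zero_le) fun i => ?_
    have : (fun x => F i x + G i x) - (fun x => f x + g x) = (F i - f) + (G i - g) := by
      ext x; simp; ring
    simp only
    rw [this]
    exact eLpNorm_add_le ((hF.memLp i).sub hF.memLp_lim).1 ((hG.memLp i).sub hG.memLp_lim).1
      (by norm_num)

lemma memLp_bdd_mul {f c : X → ℂ} (hf : MemLp f 2 μ) (hc : AEStronglyMeasurable c μ) {C : ℝ}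
    (hC : ∀ x, ‖c x‖ ≤ C) : MemLp (fun x => c x * f x) 2 μ := by
  refine hf.of_le_mul (c := C) (hc.mul hf.1) (Eventually.of_forall fun x => ?_)
  rw [norm_mul]
  gcongr
  exact hC x

lemma TendstoL2.bdd_mul {F : ℕ → X → ℂ} {f c : X → ℂ} (hF : TendstoL2 μ F f)
    (hc : AEStronglyMeasurable c μ) {C : ℝ} (hC : ∀ x, ‖c x‖ ≤ C) :
    TendstoL2 μ (fun i x => c x * F i x) (fun x => c x * f x) where
  memLp i := memLp_bdd_mul (hF.memLp i) hc hC
  memLp_lim := memLp_bdd_mul hF.memLp_lim hc hC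
  tendsto := by
    have h0 : Tendsto (fun i => ENNReal.ofReal C * eLpNorm (F i - f) 2 μ) atTop (𝓝 0) := by
      simpa using ENNReal.Tendsto.const_mul hF.tendsto (Or.inr ENNReal.ofReal_ne_top)
    refine tendsto_of_tendsto_of_tendsto_of_le_of_le tendsto_const_nhds h0
      (fun _ => zero_le) fun i => ?_
    refine eLpNorm_le_mul_eLpNorm_of_ae_le_mul (Eventually.of_forall fun x => ?_) 2
    simp only [Pi.sub_apply, ← mul_sub, norm_mul]
    gcongr
    exact hC x

lemma TendstoL2.sum {ι : Type*} {s : Finset ι} {F : ι → ℕ → X → ℂ} {f : ι → X → ℂ}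
    (hF : ∀ j ∈ s, TendstoL2 μ (F j) (f j)) :
    TendstoL2 μ (fun i x => ∑ j ∈ s, F j i x) (fun x => ∑ j ∈ s, f j x) := by
  classical
  induction s using Finset.induction_on with
  | empty =>
    simp only [Finset.sum_empty]
    exact ⟨fun _ => MemLp.zero', MemLp.zero', by simp⟩
  | insert a s ha ih =>
    simp only [Finset.sum_insert ha]
    exact (hF a (by simp)).add (ih fun j hj => hF j (by simp [hj]))

lemma TendstoL2.congr {F G : ℕ → X → ℂ} {f g : X → ℂ} (hF : TendstoL2 μ F f)
    (h : ∀ i x, F i x = G i x) (h' : ∀ x, f x = g x) : TendstoL2 μ G g := by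
  obtain rfl : F = G := funext fun i => funext (h i)
  obtain rfl : f = g := funext h'
  exact hF

lemma integral_norm_sq_eq {f : X → ℂ} (hf : MemLp f 2 μ) :
    ∫ x, ‖f x‖ ^ 2 ∂μ = (eLpNorm f 2 μ).toReal ^ 2 := by
  rw [hf.eLpNorm_eq_integral_rpow_norm (by norm_num) (by norm_num)]
  have h0 : 0 ≤ ∫ x, ‖f x‖ ^ 2 ∂μ := integral_nonneg fun x => by positivity
  simp only [ENNReal.toReal_ofNat, Real.rpow_ofNat]
  rw [ENNReal.toReal_ofReal (Real.rpow_nonneg h0 _), ← Real.rpow_natCast, ← Real.rpow_mul h0]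
  norm_num

lemma TendstoL2.tendsto_integral_norm_sq {F : ℕ → X → ℂ} {f : X → ℂ} (hF : TendstoL2 μ F f) :
    Tendsto (fun i => ∫ x, ‖F i x‖ ^ 2 ∂μ) atTop (𝓝 (∫ x, ‖f x‖ ^ 2 ∂μ)) := by
  have h1 := (Lp.tendsto_Lp_iff_tendsto_eLpNorm'' F hF.memLp f hF.memLp_lim).2 hF.tendsto
  have h2 := h1.norm.pow 2
  simp only [Lp.norm_toLp] at h2
  rw [integral_norm_sq_eq hF.memLp_lim]
  exact h2.congr fun i => (integral_norm_sq_eq (hF.memLp i)).symm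

/-- Weighted square norms with a bounded weight pass to `L²` limits. -/
lemma TendstoL2.tendsto_integral_mul_norm_sq {F : ℕ → X → ℂ} {f : X → ℂ}
    (hF : TendstoL2 μ F f) {c : X → ℝ} (hc : AEStronglyMeasurable c μ) (hc0 : ∀ x, 0 ≤ c x)
    {C : ℝ} (hC : ∀ x, c x ≤ C) :
    Tendsto (fun i => ∫ x, c x * ‖F i x‖ ^ 2 ∂μ) atTop (𝓝 (∫ x, c x * ‖f x‖ ^ 2 ∂μ)) := by
  have h1 := hF.bdd_mul (c := fun x => ((√(c x) : ℝ) : ℂ)) (C := √C)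
    (Complex.continuous_ofReal.comp_aestronglyMeasurable
      (Real.continuous_sqrt.comp_aestronglyMeasurable hc)) fun x => by
    rw [Complex.norm_real, Real.norm_of_nonneg (Real.sqrt_nonneg _)]
    exact Real.sqrt_le_sqrt (hC x)
  have h2 := h1.tendsto_integral_norm_sq
  simpa only [norm_mul, mul_pow, Complex.norm_real, Real.norm_of_nonneg (Real.sqrt_nonneg _),
    Real.sq_sqrt (hc0 _)] using h2

lemma integrable_mul_norm_sq {f : X → ℂ} (hf : MemLp f 2 μ) {c : X → ℝ}
    (hc : AEStronglyMeasurable c μ) {C : ℝ} (hC : ∀ x, |c x| ≤ C) :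
    Integrable (fun x => c x * ‖f x‖ ^ 2) μ :=
  ((memLp_two_iff_integrable_sq_norm hf.1).1 hf).bdd_mul hc (Eventually.of_forall hC)

end TendstoL2

section MollifyWirtinger

open Filter Topology ContinuousLinearMap
open scoped Convolution ComplexConjugate

variable {n : ℕ}

/-- The translated and reflected kernel `y ↦ ρ (x - y)` of a mollifier. -/
def mollifyKernel (ρ : ContDiffBump (0 : Fin n → ℂ)) (x y : Fin n → ℂ) : ℂ :=
  ((ρ.normed (volume : Measure (Fin n → ℂ)) (x - y) : ℝ) : ℂ)

lemma contDiff_mollifyKernel (ρ : ContDiffBump (0 : Fin n → ℂ)) (x : Fin n → ℂ) :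
    ContDiff ℝ (⊤ : ℕ∞) (mollifyKernel ρ x) :=
  Complex.ofRealCLM.contDiff.comp (ρ.contDiff_normed.comp (contDiff_const.sub contDiff_id))

lemma mollify_eq_integral_kernel (ρ : ContDiffBump (0 : Fin n → ℂ)) (f : (Fin n → ℂ) → ℂ)
    (x : Fin n → ℂ) : mollify volume ρ f x = ∫ y, f y * mollifyKernel ρ x y := by
  rw [mollify_apply]
  simp only [mollifyKernel, mul_comm]

lemma conj_mollify (ρ : ContDiffBump (0 : Fin n → ℂ)) (f : (Fin n → ℂ) → ℂ)
    (x : Fin n → ℂ) :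
    conj (mollify volume ρ f x) = mollify volume ρ (fun y => conj (f y)) x := by
  rw [mollify_apply, mollify_apply, ← integral_conj]
  simp

lemma integrable_mul_of_hasCompactSupport {f g : (Fin n → ℂ) → ℂ}
    (hf : LocallyIntegrable f) (hg : Continuous g) (hc : HasCompactSupport g) :
    Integrable (fun y => f y * g y) := by
  simpa only [smul_eq_mul, mul_comm] using hf.integrable_smul_left_of_hasCompactSupport hg hc

lemma hasCompactSupport_mollifyKernel (ρ : ContDiffBump (0 : Fin n → ℂ)) (x : Fin n → ℂ) :
    HasCompactSupport (mollifyKernel ρ x) := by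
  have h : HasCompactSupport fun y => ρ.normed (volume : Measure (Fin n → ℂ)) (x - y) :=
    (ρ.hasCompactSupport_normed (μ := volume)).comp_homeomorph (Homeomorph.subLeft x)
  exact h.comp_left (g := fun r : ℝ => (r : ℂ)) (by simp)

lemma fderiv_mollify_apply (ρ : ContDiffBump (0 : Fin n → ℂ)) {f : (Fin n → ℂ) → ℂ}
    (hf : LocallyIntegrable f) (x v : Fin n → ℂ) :
    fderiv ℝ (mollify volume ρ f) x v = -∫ y, f y * fderiv ℝ (mollifyKernel ρ x) y v := by
  have hρ : ContDiff ℝ 1 (ρ.normed (volume : Measure (Fin n → ℂ))) := ρ.contDiff_normed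
  have hd : Continuous (fderiv ℝ (ρ.normed (volume : Measure (Fin n → ℂ)))) :=
    hρ.continuous_fderiv (by norm_num)
  have hk : ∀ y, fderiv ℝ (mollifyKernel ρ x) y v =
      -((fderiv ℝ (ρ.normed (volume : Measure (Fin n → ℂ))) (x - y) v : ℝ) : ℂ) := by
    intro y
    have h1 : HasFDerivAt (fun y : Fin n → ℂ => x - y) (-ContinuousLinearMap.id ℝ _) y :=
      (hasFDerivAt_id y).const_sub x
    have h2 := ((hρ.differentiable (by norm_num) (x - y)).hasFDerivAt).comp y h1
    have h3 := Complex.ofRealCLM.hasFDerivAt.comp y h2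
    have h4 : fderiv ℝ (mollifyKernel ρ x) y = _ := h3.fderiv
    rw [h4]
    simp
  have hex := (ρ.hasCompactSupport_normed (μ := volume)).fderiv ℝ
    |>.convolutionExists_left ((lsmul ℝ ℝ : ℝ →L[ℝ] ℂ →L[ℝ] ℂ).precompL (Fin n → ℂ)) hd hf
  rw [mollify, ((ρ.hasCompactSupport_normed (μ := volume)).hasFDerivAt_convolution_left
    (lsmul ℝ ℝ) hρ hf x).fderiv, convolution_eq_swap]
  rw [ContinuousLinearMap.integral_apply]
  · simp [hk, integral_neg, mul_comm]
  · exact (hex x).integrable_swap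

lemma dbarCoord_mollify (ρ : ContDiffBump (0 : Fin n → ℂ)) {f : (Fin n → ℂ) → ℂ}
    (hf : LocallyIntegrable f) (j : Fin n) (x : Fin n → ℂ) :
    dbarCoord n (mollify volume ρ f) j x =
      -∫ y, f y * dbarCoord n (mollifyKernel ρ x) j y := by
  have hk : ContDiff ℝ 1 (mollifyKernel ρ x) := (contDiff_mollifyKernel ρ x).of_le (by simp)
  have hi : ∀ v, Integrable fun y => f y * fderiv ℝ (mollifyKernel ρ x) y v := fun v =>
    integrable_mul_of_hasCompactSupport hf
      ((hk.continuous_fderiv (by norm_num)).clm_apply continuous_const)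
      ((hasCompactSupport_mollifyKernel ρ x).fderiv_apply ℝ v)
  simp only [dbarCoord, fderiv_mollify_apply ρ hf]
  rw [← mul_neg_one, ← mul_neg_one, ← mul_neg_one (integral _ _)]
  have : ∀ y, f y * (1 / 2 * (fderiv ℝ (mollifyKernel ρ x) y (Pi.single j 1) +
      I * fderiv ℝ (mollifyKernel ρ x) y (Pi.single j I))) =
      1 / 2 * (f y * fderiv ℝ (mollifyKernel ρ x) y (Pi.single j 1)) +
      I / 2 * (f y * fderiv ℝ (mollifyKernel ρ x) y (Pi.single j I)) := fun y => by ring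
  simp only [this]
  rw [integral_add ((hi _).const_mul _) ((hi _).const_mul _), integral_const_mul,
    integral_const_mul]
  ring

end MollifyWirtinger

section CutoffEstimate

open Filter Topology
open scoped ComplexConjugate

variable {n : ℕ} {U : Set (Fin n → ℂ)}

lemma two_le_infty : (2 : WithTop ℕ∞) ≤ ((⊤ : ℕ∞) : WithTop ℕ∞) :=
  WithTop.coe_le_coe.2 (le_top : (2 : ℕ∞) ≤ ⊤)

lemma tendstoL2_mollify {f : (Fin n → ℂ) → ℂ} (hf : MemLp f 2)
    {ρ : ℕ → ContDiffBump (0 : Fin n → ℂ)} (hρ : Tendsto (fun i => (ρ i).rOut) atTop (𝓝 0)) :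
    TendstoL2 volume (fun i => mollify volume (ρ i) f) f where
  memLp i := ⟨(contDiff_mollify _ (hf.locallyIntegrable
    (by norm_num))).continuous.aestronglyMeasurable,
    (eLpNorm_mollify_le _ hf.1).trans_lt hf.2⟩
  memLp_lim := hf
  tendsto := tendsto_eLpNorm_mollify_sub hf hρ

lemma memLp_continuous_mul {f c : (Fin n → ℂ) → ℂ} (hf : MemLp f 2) (hc : Continuous c)
    (hcc : HasCompactSupport c) : MemLp (fun x => c x * f x) 2 := by
  obtain ⟨C, hC⟩ := hcc.exists_bound_of_continuous hc
  exact memLp_bdd_mul hf hc.aestronglyMeasurable hC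

lemma dbarCoord_mollify_mul (ρ : ContDiffBump (0 : Fin n → ℂ)) {e g : (Fin n → ℂ) → ℂ}
    (he : ContDiff ℝ 1 e) (hec : HasCompactSupport e) (hg : MemLp g 2) (k : Fin n)
    (x : Fin n → ℂ) :
    dbarCoord n (mollify volume ρ fun y => e y * g y) k x =
      -(∫ y, g y * dbarCoord n (fun y => e y * mollifyKernel ρ x y) k y)
        + mollify volume ρ (fun y => dbarCoord n e k y * g y) x := by
  have hκ : ContDiff ℝ 1 (mollifyKernel ρ x) := (contDiff_mollifyKernel ρ x).of_le (by simp)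
  have hκd := (contDiff_dbarCoord (k := 0) hκ (by norm_num) k).continuous
  have hed := (contDiff_dbarCoord (k := 0) he (by norm_num) k).continuous
  have hgl : LocallyIntegrable g := hg.locallyIntegrable (by norm_num)
  have i1 : Integrable fun y => g y * (e y * dbarCoord n (mollifyKernel ρ x) k y) :=
    integrable_mul_of_hasCompactSupport hgl (he.continuous.mul hκd)
    (hec.mul_right (f' := dbarCoord n (mollifyKernel ρ x) k))
  have i2 : Integrable fun y => g y * (dbarCoord n e k y * mollifyKernel ρ x y) :=
    integrable_mul_of_hasCompactSupport hgl (hed.mul hκ.continuous)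
    ((hasCompactSupport_dbarCoord hec k).mul_right (f' := mollifyKernel ρ x))
  rw [dbarCoord_mollify ρ ((memLp_continuous_mul hg he.continuous hec).locallyIntegrable
    (by norm_num)), mollify_eq_integral_kernel]
  have h : ∀ y, g y * dbarCoord n (fun y => e y * mollifyKernel ρ x y) k y =
      g y * (dbarCoord n e k y * mollifyKernel ρ x y) +
      g y * (e y * dbarCoord n (mollifyKernel ρ x) k y) := fun y => by
    rw [dbarCoord_mul (he.differentiable (by norm_num) y) (hκ.differentiable (by norm_num) y)]
    ring
  simp only [h]
  rw [integral_add i2 i1]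
  have e1 : ∀ y, e y * g y * dbarCoord n (mollifyKernel ρ x) k y =
      g y * (e y * dbarCoord n (mollifyKernel ρ x) k y) := fun y => by ring
  have e2 : ∀ y, dbarCoord n e k y * g y * mollifyKernel ρ x y =
      g y * (dbarCoord n e k y * mollifyKernel ρ x y) := fun y => by ring
  simp only [e1, e2]
  ring

lemma dbarCoord_mollify_cutoff_sub (ρ : ContDiffBump (0 : Fin n → ℂ)) {e : (Fin n → ℂ) → ℂ}
    {G : Fin n → (Fin n → ℂ) → ℂ} (he : IsTest n U e) (hG : ∀ j, MemLp (G j) 2)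
    (ha : ∀ j k σ, IsTest n U σ → ∫ z, G j z * dbarCoord n σ k z = ∫ z, G k z * dbarCoord n σ j z)
    (j k : Fin n) (x : Fin n → ℂ) :
    dbarCoord n (mollify volume ρ fun y => e y * G j y) k x -
      dbarCoord n (mollify volume ρ fun y => e y * G k y) j x =
    mollify volume ρ (fun y => dbarCoord n e k y * G j y) x -
      mollify volume ρ (fun y => dbarCoord n e j y * G k y) x := by
  have he1 : ContDiff ℝ 1 e := he.1.of_le (by simp)
  rw [dbarCoord_mollify_mul ρ he1 he.2.1 (hG j), dbarCoord_mollify_mul ρ he1 he.2.1 (hG k),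
    ha j k _ ⟨he.1.mul (contDiff_mollifyKernel ρ x), he.2.1.mul_right,
      (tsupport_mul_subset_left).trans he.2.2⟩]
  ring

lemma sum_dbarCoord_mollify_conj (ρ : ContDiffBump (0 : Fin n → ℂ)) {W : (Fin n → ℂ) → ℝ}
    (hW : ContDiff ℝ 2 W) {e h : (Fin n → ℂ) → ℂ} {G : Fin n → (Fin n → ℂ) → ℂ}
    (he : IsTest n U e) (hG : ∀ j, MemLp (G j) 2)
    (hb : ∀ χ, ContDiff ℝ 2 χ → HasCompactSupport χ → tsupport χ ⊆ U →
      ∫ z, ∑ j, conj (G j z) * cexp (-(W z : ℂ)) * dbarCoord n χ j z = -∫ z, χ z * h z)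
    (x : Fin n → ℂ) :
    ∑ j, dbarCoord n (mollify volume ρ fun y => e y * conj (G j y)) j x =
      mollify volume ρ (fun y => cexp (W y) * e y * h y) x +
      ∑ j, (mollify volume ρ (fun y => dbarCoord n e j y * conj (G j y)) x +
        mollify volume ρ (fun y => dbarCoord n (fun w => (W w : ℂ)) j y *
          (e y * conj (G j y))) x) := by
  have he2 : ContDiff ℝ 2 e := he.1.of_le two_le_infty
  have he1 : ContDiff ℝ 1 e := he.1.of_le (by simp)
  have hWc : ContDiff ℝ 2 fun w => (W w : ℂ) := Complex.ofRealCLM.contDiff.comp hW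
  have hEc : ContDiff ℝ 2 fun w => cexp (W w : ℂ) := hWc.cexp
  have hκ : ContDiff ℝ 2 (mollifyKernel ρ x) :=
    (contDiff_mollifyKernel ρ x).of_le two_le_infty
  have hGc : ∀ j, MemLp (fun y => conj (G j y)) 2 := fun j => (hG j).star
  have hGl : ∀ j, LocallyIntegrable (fun y => conj (G j y)) := fun j =>
    (hGc j).locallyIntegrable (by norm_num)
  set σ : (Fin n → ℂ) → ℂ := fun y => e y * mollifyKernel ρ x y with hσ
  have hσ2 : ContDiff ℝ 2 σ := he2.mul hκ
  have hσc : HasCompactSupport σ := he.2.1.mul_right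
  have hdσ := fun j => (contDiff_dbarCoord (k := 0) hσ2 (by norm_num) j).continuous
  have hdW := fun j => (contDiff_dbarCoord (k := 0) hWc (by norm_num) j).continuous
  have key := hb (fun y => cexp (W y) * σ y) (hEc.mul hσ2) hσc.mul_left
    ((tsupport_mul_subset_right).trans ((tsupport_mul_subset_left).trans he.2.2))
  have hdχ : ∀ j y, conj (G j y) * cexp (-(W y : ℂ)) * dbarCoord n (fun y => cexp (W y) * σ y) j y =
      conj (G j y) * dbarCoord n σ j y +
      conj (G j y) * (dbarCoord n (fun w => (W w : ℂ)) j y * σ y) := fun j y => by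
    have hE : dbarCoord n (fun w => cexp (W w : ℂ)) j y =
        cexp (W y) * dbarCoord n (fun w => (W w : ℂ)) j y := by
      simp only [dbarCoord]
      rw [((hWc.differentiable (by norm_num) y).hasFDerivAt.cexp).fderiv]
      simp
      ring
    rw [dbarCoord_mul (hEc.differentiable (by norm_num) y) (hσ2.differentiable (by norm_num) y),
      hE, Complex.exp_neg]
    field_simp [Complex.exp_ne_zero]
    ring
  simp only [hdχ] at key
  have i1 : ∀ j, Integrable fun y => conj (G j y) * dbarCoord n σ j y := fun j =>
    integrable_mul_of_hasCompactSupport (hGl j) (hdσ j) (hasCompactSupport_dbarCoord hσc j)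
  have i2 : ∀ j, Integrable fun y =>
      conj (G j y) * (dbarCoord n (fun w => (W w : ℂ)) j y * σ y) := fun j =>
    integrable_mul_of_hasCompactSupport (hGl j) ((hdW j).mul hσ2.continuous) hσc.mul_left
  rw [integral_finsetSum _ fun j _ => by exact (i1 j).add (i2 j)] at key
  simp only [fun j => integral_add (i1 j) (i2 j)] at key
  simp only [dbarCoord_mollify_mul ρ he1 he.2.1 (hGc _)]
  have e1 : ∫ y, cexp (W y) * σ y * h y =
      mollify volume ρ (fun y => cexp (W y) * e y * h y) x := by
    rw [mollify_eq_integral_kernel]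
    refine integral_congr_ae (Eventually.of_forall fun y => ?_)
    simp only [hσ]; ring
  have e2 : ∀ j, ∫ y, conj (G j y) * (dbarCoord n (fun w => (W w : ℂ)) j y * σ y) =
      mollify volume ρ (fun y => dbarCoord n (fun w => (W w : ℂ)) j y *
          (e y * conj (G j y))) x := fun j => by
    rw [mollify_eq_integral_kernel]
    refine integral_congr_ae (Eventually.of_forall fun y => ?_)
    simp only [hσ]; ring
  rw [e1] at key
  simp only [e2] at key
  simp only [Finset.sum_add_distrib, Finset.sum_neg_distrib] at key ⊢
  linear_combination -key

end CutoffEstimate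

section CutoffEstimateLimit

open Filter Topology
open scoped ComplexConjugate

variable {n : ℕ} {U : Set (Fin n → ℂ)}

lemma exists_bump_seq {δ : ℝ} (hδ : 0 < δ) :
    ∃ ρ : ℕ → ContDiffBump (0 : Fin n → ℂ), (∀ i, (ρ i).rOut ≤ δ) ∧
      Tendsto (fun i => (ρ i).rOut) atTop (𝓝 0) := by
  refine ⟨fun i => ⟨δ / (i + 1) / 2, δ / (i + 1), by positivity, half_lt_self (by positivity)⟩,
    fun i => div_le_self hδ.le (by simp), ?_⟩
  refine ((tendsto_const_div_atTop_nhds_zero_nat δ).comp (tendsto_add_atTop_nat 1)).congr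
    fun i => ?_
  simp

lemma norm_add_sq_le_two_mul (a b : ℂ) : ‖a + b‖ ^ 2 ≤ 2 * ‖a‖ ^ 2 + 2 * ‖b‖ ^ 2 := by
  have := norm_add_le a b
  nlinarith [norm_nonneg (a + b), sq_nonneg (‖a‖ - ‖b‖)]

lemma norm_sum_mul_sq_le {ι : Type*} (s : Finset ι) (a b : ι → ℂ) :
    ‖∑ j ∈ s, a j * b j‖ ^ 2 ≤ (∑ j ∈ s, ‖a j‖ ^ 2) * ∑ j ∈ s, ‖b j‖ ^ 2 := by
  refine le_trans ?_ (Finset.sum_mul_sq_le_sq_mul_sq s (fun j => ‖a j‖) fun j => ‖b j‖)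
  gcongr
  exact (norm_sum_le _ _).trans_eq (by simp)

lemma half_sum_norm_sub_sq_le (a b : Fin n → ℂ) :
    (1 / 2) * ∑ j, ∑ k, ‖a k * b j - a j * b k‖ ^ 2 ≤
      2 * ((∑ j, ‖a j‖ ^ 2) * ∑ j, ‖b j‖ ^ 2) := by
  have h1 : ∀ j k, ‖a k * b j - a j * b k‖ ^ 2 ≤
      2 * (‖a k‖ ^ 2 * ‖b j‖ ^ 2) + 2 * (‖a j‖ ^ 2 * ‖b k‖ ^ 2) := fun j k => by
    have := norm_add_sq_le_two_mul (a k * b j) (-(a j * b k))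
    rwa [← sub_eq_add_neg, norm_neg, norm_mul, norm_mul, mul_pow, mul_pow] at this
  have h2 := Finset.sum_le_sum fun j (_ : j ∈ Finset.univ) =>
    Finset.sum_le_sum fun k (_ : k ∈ Finset.univ) => h1 j k
  have h3 : ∑ j, ∑ k, ‖a k‖ ^ 2 * ‖b j‖ ^ 2 = (∑ j, ‖a j‖ ^ 2) * ∑ j, ‖b j‖ ^ 2 := by
    rw [Finset.sum_mul_sum, Finset.sum_comm]
  have h4 : ∑ j, ∑ k, ‖a j‖ ^ 2 * ‖b k‖ ^ 2 = (∑ j, ‖a j‖ ^ 2) * ∑ j, ‖b j‖ ^ 2 := by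
    rw [Finset.sum_mul_sum]
  have h5 : ∑ j, ∑ k, (2 * (‖a k‖ ^ 2 * ‖b j‖ ^ 2) + 2 * (‖a j‖ ^ 2 * ‖b k‖ ^ 2)) =
      2 * (∑ j, ∑ k, ‖a k‖ ^ 2 * ‖b j‖ ^ 2) + 2 * ∑ j, ∑ k, ‖a j‖ ^ 2 * ‖b k‖ ^ 2 := by
    simp only [Finset.sum_add_distrib, Finset.mul_sum]
  rw [h5, h3, h4] at h2
  linarith

lemma continuous_hessC_apply {W : (Fin n → ℂ) → ℝ} (hW : ContDiff ℝ 2 W)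
    {ξ : (Fin n → ℂ) → Fin n → ℂ} (hξ : Continuous ξ) : Continuous fun z => hessC n W z (ξ z) := by
  have hWc : ContDiff ℝ 2 fun w => (W w : ℂ) := Complex.ofRealCLM.contDiff.comp hW
  simp only [fun z => hessC_eq_re_sum hW.contDiffAt (z := z) (ξ z)]
  have hd : ∀ j k, Continuous (dbarCoord n (delCoord n (fun w => (W w : ℂ)) j) k) := fun j k =>
    (contDiff_dbarCoord (k := 0) (contDiff_delCoord (k := 1) hWc (by norm_num) j)
      (by norm_num) k).continuous
  have hξj : ∀ j, Continuous fun z => ξ z j := fun j => (continuous_apply j).comp hξ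
  refine continuous_finsetSum _ fun j _ => continuous_finsetSum _ fun k _ => ?_
  exact Complex.continuous_re.comp (((hd j k).mul (hξj j)).mul
    (Complex.continuous_conj.comp (hξj k)))

lemma hessC_zero (f : (Fin n → ℂ) → ℝ) (z : Fin n → ℂ) : hessC n f z 0 = 0 := by
  have h := (iteratedFDeriv ℝ 2 f z).map_coord_zero (m := ![0, 0]) 0 (by simp)
  simp [hessC, h]

lemma enormSq_eq_sum_norm_sq (ξ : Fin n → ℂ) : enormSq n ξ = ∑ j, ‖ξ j‖ ^ 2 := by
  simp [enormSq, Complex.normSq_eq_norm_sq]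

lemma tendstoL2_conj_sum_weightedDel {W : (Fin n → ℂ) → ℝ}
    (hW : ContDiff ℝ 2 W) (hWc : HasCompactSupport W) {e h : (Fin n → ℂ) → ℂ}
    {G : Fin n → (Fin n → ℂ) → ℂ} (he : IsTest n U e) (her : ∀ z, conj (e z) = e z)
    (hh : Continuous h) (hG : ∀ j, MemLp (G j) 2)
    (hb : ∀ χ, ContDiff ℝ 2 χ → HasCompactSupport χ → tsupport χ ⊆ U →
      ∫ z, ∑ j, conj (G j z) * cexp (-(W z : ℂ)) * dbarCoord n χ j z = -∫ z, χ z * h z)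
    {ρ : ℕ → ContDiffBump (0 : Fin n → ℂ)} (hρ : Tendsto (fun i => (ρ i).rOut) atTop (𝓝 0)) :
    TendstoL2 volume
      (fun i x => conj (∑ j, weightedDel n W (mollify volume (ρ i) fun y => e y * G j y) j x))
      (fun x => cexp (W x) * e x * h x + ∑ j, dbarCoord n e j x * conj (G j x)) := by
  have he1 : ContDiff ℝ 1 e := he.1.of_le (by simp)
  have hWcc : ContDiff ℝ 2 fun w => (W w : ℂ) := Complex.ofRealCLM.contDiff.comp hW
  have hWs : HasCompactSupport fun w => (W w : ℂ) := hWc.comp_left (g := Complex.ofReal) rfl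
  have hGc : ∀ j, MemLp (fun y => conj (G j y)) 2 := fun j => (hG j).star
  have hdW := fun j => (contDiff_dbarCoord (k := 0) hWcc (by norm_num) j).continuous
  have hdWs := fun j => hasCompactSupport_dbarCoord hWs j
  have hde := fun j => (contDiff_dbarCoord (k := 0) he1 (by norm_num) j).continuous
  have m0 : MemLp (fun y => cexp (W y) * e y * h y) 2 :=
    (((hWcc.continuous.cexp.mul he1.continuous).mul hh)).memLp_of_hasCompactSupport
      he.2.1.mul_left.mul_right
  have m1 : ∀ j, MemLp (fun y => dbarCoord n e j y * conj (G j y)) 2 := fun j =>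
    memLp_continuous_mul (hGc j) (hde j) (hasCompactSupport_dbarCoord he.2.1 j)
  have m2 : ∀ j, MemLp (fun y => e y * conj (G j y)) 2 := fun j =>
    memLp_continuous_mul (hGc j) he1.continuous he.2.1
  have m3 : ∀ j, MemLp (fun y => dbarCoord n (fun w => (W w : ℂ)) j y * (e y * conj (G j y))) 2 :=
    fun j => memLp_continuous_mul (m2 j) (hdW j) (hdWs j)
  have t2 : ∀ j, TendstoL2 volume
      (fun i x => -dbarCoord n (fun w => (W w : ℂ)) j x *
        mollify volume (ρ i) (fun y => e y * conj (G j y)) x)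
      (fun x => -dbarCoord n (fun w => (W w : ℂ)) j x * (e x * conj (G j x))) := fun j => by
    obtain ⟨C, hC⟩ := (hdWs j).exists_bound_of_continuous (hdW j)
    exact (tendstoL2_mollify (m2 j) hρ).bdd_mul (hdW j).neg.aestronglyMeasurable (C := C)
      fun x => by rw [norm_neg]; exact hC x
  have t := (tendstoL2_mollify m0 hρ).add (TendstoL2.sum (s := Finset.univ) fun j _ =>
    ((tendstoL2_mollify (m1 j) hρ).add (tendstoL2_mollify (m3 j) hρ)).add (t2 j))
  refine t.congr (fun i x => ?_) fun x => ?_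
  · have h1 : ∀ j, (mollify volume (ρ i) fun y => e y * G j y) =
        fun x => conj (mollify volume (ρ i) (fun y => e y * conj (G j y)) x) := fun j => by
      ext x
      rw [conj_mollify]
      simp [her]
    have h2 : ∀ j, delCoord n (fun w => (W w : ℂ)) j x =
        conj (dbarCoord n (fun w => (W w : ℂ)) j x) := fun j => by
      rw [← delCoord_conj]
      simp
    have h3 := sum_dbarCoord_mollify_conj (ρ i) hW he hG hb x
    simp only [weightedDel, h1, delCoord_conj, h2, map_sum, map_sub, map_mul, Complex.conj_conj]
    simp only [Finset.sum_add_distrib, Finset.sum_sub_distrib, neg_mul,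
      Finset.sum_neg_distrib] at h3 ⊢
    rw [h3]
    ring
  · congr 1
    refine Finset.sum_congr rfl fun j _ => ?_
    ring

/-- The Morrey-Kohn-Hörmander inequality for a cut-off square-integrable form satisfying its
equations only in the sense of distributions. -/
lemma cutoff_estimate_of_compact_weight {W : (Fin n → ℂ) → ℝ} (hU : IsOpen U)
    (hW : ContDiff ℝ 2 W) (hWc : HasCompactSupport W) {m : (Fin n → ℂ) → ℝ} (hm : Measurable m)
    (hm0 : ∀ z, 0 ≤ m z) {C : ℝ} (hmC : ∀ z, m z ≤ C)
    (hmW : ∀ z ∈ U, ∀ ξ, m z * enormSq n ξ ≤ hessC n W z ξ)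
    {h : (Fin n → ℂ) → ℂ} {G : Fin n → (Fin n → ℂ) → ℂ} (hh : Continuous h)
    (hG : ∀ j, MemLp (G j) 2)
    (ha : ∀ j k σ, IsTest n U σ → ∫ z, G j z * dbarCoord n σ k z = ∫ z, G k z * dbarCoord n σ j z)
    (hb : ∀ χ, ContDiff ℝ 2 χ → HasCompactSupport χ → tsupport χ ⊆ U →
      ∫ z, ∑ j, conj (G j z) * cexp (-(W z : ℂ)) * dbarCoord n χ j z = -∫ z, χ z * h z)
    {η : (Fin n → ℂ) → ℝ} (hη : IsTest n U fun z => (η z : ℂ)) :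
    ∫ z, m z * η z ^ 2 * (∑ j, ‖G j z‖ ^ 2) * Real.exp (-W z) ≤
      2 * (∫ z, η z ^ 2 * ‖h z‖ ^ 2 * Real.exp (W z)) +
      4 * ∫ z, (∑ j, ‖dbarCoord n (fun z => (η z : ℂ)) j z‖ ^ 2) * (∑ j, ‖G j z‖ ^ 2) *
        Real.exp (-W z) := by
  set e : (Fin n → ℂ) → ℂ := fun z => (η z : ℂ) with he
  have he1 : ContDiff ℝ 1 e := hη.1.of_le (by simp)
  have hηc : Continuous η := by
    have : η = fun z => (e z).re := by ext z; simp [he]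
    rw [this]; exact Complex.continuous_re.comp he1.continuous
  have hde := fun j => (contDiff_dbarCoord (k := 0) he1 (by norm_num) j).continuous
  have hdes := fun j => hasCompactSupport_dbarCoord hη.2.1 j
  obtain ⟨δ, hδ, hδU⟩ := hη.2.1.isCompact.exists_cthickening_subset_open hU hη.2.2
  obtain ⟨ρ, hρδ, hρ⟩ := exists_bump_seq (n := n) hδ
  obtain ⟨CW, hCW⟩ := hWc.exists_bound_of_continuous hW.continuous
  set c : (Fin n → ℂ) → ℝ := fun z => Real.exp (-W z) with hc
  have hcc : Continuous c := Real.continuous_exp.comp hW.continuous.neg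
  have hc0 : ∀ z, 0 ≤ c z := fun z => (Real.exp_pos _).le
  have hcC : ∀ z, c z ≤ Real.exp CW := fun z =>
    Real.exp_le_exp.2 ((neg_le_abs _).trans (hCW z))
  have hC0 : 0 ≤ C := (hm0 0).trans (hmC 0)
  have hmcm : AEStronglyMeasurable (fun z => m z * c z) :=
    (hm.mul hcc.measurable).aestronglyMeasurable
  have hmc0 : ∀ z, 0 ≤ m z * c z := fun z => mul_nonneg (hm0 z) (hc0 z)
  have hmcC : ∀ z, m z * c z ≤ C * Real.exp CW := fun z =>
    mul_le_mul (hmC z) (hcC z) (hc0 z) hC0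
  set F : ℕ → Fin n → (Fin n → ℂ) → ℂ := fun i j => mollify volume (ρ i) fun y => e y * G j y
    with hFdef
  have mF : ∀ j, MemLp (fun y => e y * G j y) 2 := fun j =>
    memLp_continuous_mul (hG j) he1.continuous hη.2.1
  have mD : ∀ j k, MemLp (fun y => dbarCoord n e k y * G j y) 2 := fun j k =>
    memLp_continuous_mul (hG j) (hde k) (hdes k)
  have hFs : ∀ i j, ContDiff ℝ (⊤ : ℕ∞) (F i j) := fun i j =>
    contDiff_mollify _ ((mF j).locallyIntegrable (by norm_num))
  have hF2 : ∀ i j, ContDiff ℝ 2 (F i j) := fun i j => (hFs i j).of_le two_le_infty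
  have hFt : ∀ i j, tsupport (F i j) ⊆ cthickening δ (tsupport e) := fun i j =>
    (tsupport_mollify_subset _ _).trans ((cthickening_mono (hρδ i) _).trans
      (cthickening_subset_of_subset _ (tsupport_mul_subset_left (f := e) (g := G j))))
  have hFc : ∀ i j, HasCompactSupport (F i j) := fun i j =>
    hη.2.1.isCompact.cthickening.of_isClosed_subset (isClosed_tsupport _) (hFt i j)
  have tF : ∀ j, TendstoL2 volume (fun i => F i j) (fun y => e y * G j y) := fun j =>
    tendstoL2_mollify (mF j) hρ
  have tD : ∀ j k, TendstoL2 volume (fun i x => dbarCoord n (F i j) k x - dbarCoord n (F i k) j x)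
      (fun x => dbarCoord n e k x * G j x - dbarCoord n e j x * G k x) := fun j k => by
    have hneg := (tendstoL2_mollify (mD k j) hρ).bdd_mul (c := fun _ => -1) (C := 1)
      aestronglyMeasurable_const (by simp)
    refine ((tendstoL2_mollify (mD j k) hρ).add hneg).congr (fun i x => ?_) fun x => by ring
    simp only [hFdef]
    rw [dbarCoord_mollify_cutoff_sub (ρ i) hη hG ha]
    ring
  have tS := tendstoL2_conj_sum_weightedDel hW hWc hη (fun z => Complex.conj_ofReal _) hh hG hb hρ
  have hle : ∀ i, ∑ j, ∫ z, m z * c z * ‖F i j z‖ ^ 2 ≤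
      (∫ z, c z * ‖conj (∑ j, weightedDel n W (F i j) j z)‖ ^ 2) +
      (1 / 2) * ∑ j, ∑ k, ∫ z, c z * ‖dbarCoord n (F i j) k z - dbarCoord n (F i k) j z‖ ^ 2 := by
    intro i
    have hmkh := morrey_kohn_hormander hW (hF2 i) (hFc i)
    have iF : ∀ j, Integrable fun z => m z * c z * ‖F i j z‖ ^ 2 := fun j =>
      integrable_mul_norm_sq ((tF j).memLp i) hmcm fun z => by
        rw [abs_of_nonneg (hmc0 z)]; exact hmcC z
    have iD : ∀ j k, Integrable fun z =>
        c z * ‖dbarCoord n (F i j) k z - dbarCoord n (F i k) j z‖ ^ 2 := fun j k =>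
      integrable_mul_norm_sq ((tD j k).memLp i) hcc.aestronglyMeasurable fun z => by
        rw [abs_of_nonneg (hc0 z)]; exact hcC z
    have e3 : (∫ z, c z * ‖conj (∑ j, weightedDel n W (F i j) j z)‖ ^ 2) =
        ∫ z, ‖∑ j, weightedDel n W (F i j) j z‖ ^ 2 * Real.exp (-W z) := by
      refine integral_congr_ae (Eventually.of_forall fun z => ?_)
      simp only [RCLike.norm_conj, hc]; ring
    have e4 : ∑ j, ∑ k, ∫ z, c z * ‖dbarCoord n (F i j) k z - dbarCoord n (F i k) j z‖ ^ 2 =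
        ∫ z, (∑ j, ∑ k, ‖dbarCoord n (F i j) k z - dbarCoord n (F i k) j z‖ ^ 2) *
          Real.exp (-W z) := by
      simp only [← integral_finsetSum _ fun k _ => iD _ k]
      rw [← integral_finsetSum _ fun j _ => integrable_finsetSum _ fun k _ => iD j k]
      refine integral_congr_ae (Eventually.of_forall fun z => ?_)
      simp only [Finset.sum_mul, hc]
      exact Finset.sum_congr rfl fun j _ => Finset.sum_congr rfl fun k _ => mul_comm _ _
    rw [e3, e4, ← integral_finsetSum _ fun j _ => iF j]
    refine le_trans ?_ hmkh
    refine integral_mono (integrable_finsetSum _ fun j _ => iF j) ?_ fun z => ?_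
    · refine Continuous.integrable_of_hasCompactSupport
        ((continuous_hessC_apply hW (continuous_pi fun j => (hFs i j).continuous)).mul hcc) ?_
      refine HasCompactSupport.intro (K := cthickening δ (tsupport e)) hη.2.1.isCompact.cthickening
        fun z hz => ?_
      have : (fun j => F i j z) = 0 := by
        ext j
        exact image_eq_zero_of_notMem_tsupport fun h => hz (hFt i j h)
      rw [this, hessC_zero, zero_mul]
    · simp only
      have e5 : ∑ j, m z * c z * ‖F i j z‖ ^ 2 = m z * enormSq n (fun j => F i j z) * c z := by
        rw [enormSq_eq_sum_norm_sq, Finset.mul_sum, Finset.sum_mul]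
        exact Finset.sum_congr rfl fun j _ => by ring
      rw [e5]
      refine mul_le_mul_of_nonneg_right ?_ (hc0 z)
      by_cases hz : z ∈ U
      · exact hmW z hz _
      · have : (fun j => F i j z) = 0 := by
          ext j
          exact image_eq_zero_of_notMem_tsupport fun h => hz (hδU (hFt i j h))
        rw [this, hessC_zero]
        simp [enormSq]
  have l1 := tendsto_finsetSum Finset.univ fun j _ =>
    (tF j).tendsto_integral_mul_norm_sq hmcm hmc0 hmcC
  have l2 := tS.tendsto_integral_mul_norm_sq hcc.aestronglyMeasurable hc0 hcC
  have l3 := tendsto_finsetSum Finset.univ fun j _ => tendsto_finsetSum Finset.univ fun k _ =>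
    (tD j k).tendsto_integral_mul_norm_sq hcc.aestronglyMeasurable hc0 hcC
  have hlim := le_of_tendsto_of_tendsto' l1 (l2.add (l3.const_mul (1 / 2))) hle
  have iF : ∀ j, Integrable fun z => m z * c z * ‖e z * G j z‖ ^ 2 := fun j =>
    integrable_mul_norm_sq (mF j) hmcm fun z => by
      rw [abs_of_nonneg (hmc0 z)]; exact hmcC z
  have iP : Integrable fun z => c z *
      ‖cexp (W z) * e z * h z + ∑ j, dbarCoord n e j z * conj (G j z)‖ ^ 2 :=
    integrable_mul_norm_sq tS.memLp_lim hcc.aestronglyMeasurable fun z => by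
      rw [abs_of_nonneg (hc0 z)]; exact hcC z
  have iD : ∀ j k, Integrable fun z =>
      c z * ‖dbarCoord n e k z * G j z - dbarCoord n e j z * G k z‖ ^ 2 := fun j k =>
    integrable_mul_norm_sq (tD j k).memLp_lim hcc.aestronglyMeasurable fun z => by
      rw [abs_of_nonneg (hc0 z)]; exact hcC z
  have iH : Integrable fun z => η z ^ 2 * ‖h z‖ ^ 2 * Real.exp (W z) := by
    refine Continuous.integrable_of_hasCompactSupport (((hηc.pow 2).mul (hh.norm.pow 2)).mul
      (Real.continuous_exp.comp hW.continuous)) ?_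
    refine HasCompactSupport.intro hη.2.1.isCompact fun z hz => ?_
    have : η z = 0 := by
      have := image_eq_zero_of_notMem_tsupport hz
      simpa [he] using this
    simp [this]
  have iG : Integrable fun z => (∑ j, ‖dbarCoord n e j z‖ ^ 2) * (∑ j, ‖G j z‖ ^ 2) *
      Real.exp (-W z) := by
    have : ∀ j k, Integrable fun z => c z * ‖dbarCoord n e k z * G j z‖ ^ 2 := fun j k =>
      integrable_mul_norm_sq (mD j k) hcc.aestronglyMeasurable fun z => by
        rw [abs_of_nonneg (hc0 z)]; exact hcC z
    refine (integrable_finsetSum Finset.univ fun k _ =>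
      integrable_finsetSum Finset.univ fun j _ => this j k).congr (Eventually.of_forall fun z => ?_)
    simp only [Finset.sum_mul_sum]
    simp only [Finset.sum_mul, norm_mul, mul_pow, hc]
    exact Finset.sum_congr rfl fun j _ => Finset.sum_congr rfl fun k _ => mul_comm _ _
  simp only [← integral_finsetSum _ fun k _ => iD _ k] at hlim
  rw [← integral_finsetSum _ fun j _ => iF j,
    ← integral_finsetSum _ fun j _ => integrable_finsetSum _ fun k _ => iD j k,
    ← integral_const_mul, ← integral_add iP ((integrable_finsetSum _ fun j _ =>
      integrable_finsetSum _ fun k _ => iD j k).const_mul _)] at hlim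
  rw [← integral_const_mul, ← integral_const_mul, ← integral_add (iH.const_mul _) (iG.const_mul _)]
  refine le_trans (le_of_eq ?_) (hlim.trans (integral_mono (iP.add ((integrable_finsetSum _
    fun j _ => integrable_finsetSum _ fun k _ => iD j k).const_mul _))
    ((iH.const_mul _).add (iG.const_mul _)) fun z => ?_))
  · refine integral_congr_ae (Eventually.of_forall fun z => ?_)
    simp only [norm_mul, mul_pow, hc, Finset.mul_sum, Finset.sum_mul]
    refine Finset.sum_congr rfl fun j _ => ?_
    simp only [he, Complex.norm_real, Real.norm_eq_abs, sq_abs]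
    ring
  · have b1 := norm_add_sq_le_two_mul (cexp (W z) * e z * h z)
      (∑ j, dbarCoord n e j z * conj (G j z))
    have b2 := norm_sum_mul_sq_le Finset.univ (fun j => dbarCoord n e j z) fun j => conj (G j z)
    have b3 := half_sum_norm_sub_sq_le (fun j => dbarCoord n e j z) fun j => G j z
    simp only [RCLike.norm_conj] at b2
    have b4 : c z * ‖cexp (W z) * e z * h z‖ ^ 2 = η z ^ 2 * ‖h z‖ ^ 2 * Real.exp (W z) := by
      simp only [norm_mul, mul_pow, Complex.norm_exp, Complex.ofReal_re, he, Complex.norm_real,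
        Real.norm_eq_abs, sq_abs, hc, Real.exp_neg]
      field_simp
    have b5 := mul_le_mul_of_nonneg_left b1 (hc0 z)
    have b6 := mul_le_mul_of_nonneg_left b2 (hc0 z)
    have b7 := mul_le_mul_of_nonneg_left b3 (hc0 z)
    simp only [← Finset.mul_sum]
    change _ ≤ 2 * (η z ^ 2 * ‖h z‖ ^ 2 * Real.exp (W z)) + 4 * (_ * _ * c z)
    linarith

end CutoffEstimateLimit

section Localization

open Filter Topology
open scoped ComplexConjugate

variable {n : ℕ} {U : Set (Fin n → ℂ)}

lemma exists_smooth_cutoff {K : Set (Fin n → ℂ)} (hK : IsCompact K) (hU : IsOpen U) (hKU : K ⊆ U) :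
    ∃ κ : (Fin n → ℂ) → ℝ, ContDiff ℝ (⊤ : ℕ∞) κ ∧ HasCompactSupport κ ∧ tsupport κ ⊆ U ∧
      ∃ O, IsOpen O ∧ K ⊆ O ∧ O ⊆ U ∧ ∀ z ∈ O, κ z = 1 := by
  obtain ⟨L, hL, hKL, hLU⟩ := exists_compact_between hK hU hKU
  obtain ⟨f, hf, hf0, -⟩ := exists_contMDiffMap_one_nhds_of_subset_interior
    (modelWithCornersSelf ℝ (Fin n → ℂ)) (n := ((⊤ : ℕ∞))) hK.isClosed hKL
  have hs : tsupport f ⊆ L := closure_minimal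
    (fun z hz => by_contra fun hzL => hz (hf0 z hzL)) hL.isClosed
  obtain ⟨O, hO, hKO, hO1⟩ := mem_nhdsSet_iff_exists.1 hf
  exact ⟨f, f.contMDiff.contDiff, hL.of_isClosed_subset (isClosed_tsupport _) hs, hs.trans hLU,
    O ∩ U, hO.inter hU, subset_inter hKO hKU, inter_subset_right, fun z hz => hO1 hz.1⟩

lemma hessC_congr {f g : (Fin n → ℂ) → ℝ} {z : Fin n → ℂ} (h : f =ᶠ[𝓝 z] g) (ξ : Fin n → ℂ) :
    hessC n f z ξ = hessC n g z ξ := by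
  simp only [hessC, (h.iteratedFDeriv (𝕜 := ℝ) 2).eq_of_nhds]

lemma contDiff_mul_of_tsupport_subset {𝔸 : Type*} [NormedRing 𝔸] [NormedAlgebra ℝ 𝔸]
    {k : WithTop ℕ∞} {κ f : (Fin n → ℂ) → 𝔸} (hU : IsOpen U) (hκ : ContDiff ℝ k κ)
    (hs : tsupport κ ⊆ U) (hf : ContDiffOn ℝ k f U) : ContDiff ℝ k fun z => κ z * f z := by
  rw [contDiff_iff_contDiffAt]
  intro z
  by_cases hz : z ∈ tsupport κ
  · exact hκ.contDiffAt.mul (hf.contDiffAt (hU.mem_nhds (hs hz)))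
  · refine (contDiffAt_const (c := 0)).congr_of_eventuallyEq ?_
    filter_upwards [notMem_tsupport_iff_eventuallyEq.1 hz] with w hw
    simp [hw]

/-- The cut-off estimate for a weight of class `C²` near the support of the cut-off only. -/
lemma cutoff_estimate {W : (Fin n → ℂ) → ℝ} (hU : IsOpen U) (hW : ContDiffOn ℝ 2 W U)
    {m : (Fin n → ℂ) → ℝ} (hm : Measurable m)
    (hm0 : ∀ z, 0 ≤ m z) {C : ℝ} (hmC : ∀ z, m z ≤ C)
    (hmW : ∀ z ∈ U, ∀ ξ, m z * enormSq n ξ ≤ hessC n W z ξ)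
    {h : (Fin n → ℂ) → ℂ} {t : Fin n → (Fin n → ℂ) → ℂ} (hh : Continuous h)
    (ht : ∀ j, MemLp (t j) 2)
    (ha : ∀ j k σ, IsTest n U σ → ∫ z, cexp ((W z : ℂ) / 2) * t j z * dbarCoord n σ k z =
      ∫ z, cexp ((W z : ℂ) / 2) * t k z * dbarCoord n σ j z)
    (hb : ∀ χ, ContDiff ℝ 2 χ → HasCompactSupport χ → tsupport χ ⊆ U →
      ∫ z, ∑ j, conj (t j z) * cexp (-(W z : ℂ) / 2) * dbarCoord n χ j z = -∫ z, χ z * h z)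
    {η : (Fin n → ℂ) → ℝ} (hη : IsTest n U fun z => (η z : ℂ)) :
    ∫ z, m z * η z ^ 2 * (∑ j, ‖t j z‖ ^ 2) ≤
      2 * (∫ z, η z ^ 2 * ‖h z‖ ^ 2 * Real.exp (W z)) +
      4 * ∫ z, (∑ j, ‖dbarCoord n (fun z => (η z : ℂ)) j z‖ ^ 2) * (∑ j, ‖t j z‖ ^ 2) := by
  obtain ⟨κ, hκ, hκc, hκU, O, hO, hKO, hOU, hκ1⟩ := exists_smooth_cutoff hη.2.1.isCompact hU hη.2.2
  set V : (Fin n → ℂ) → ℝ := fun z => κ z * W z with hV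
  have hVW : ∀ z ∈ O, V z = W z := fun z hz => by simp [hV, hκ1 z hz]
  have hV2 : ContDiff ℝ 2 V :=
    contDiff_mul_of_tsupport_subset hU (hκ.of_le two_le_infty) hκU hW
  have hVc : HasCompactSupport V := hκc.mul_right
  obtain ⟨D, hD⟩ := hVc.exists_bound_of_continuous hV2.continuous
  have hVm : Continuous fun z => cexp ((V z : ℂ) / 2) :=
    ((Complex.continuous_ofReal.comp hV2.continuous).div_const 2).cexp
  have hO0 : ∀ {z} {σ : (Fin n → ℂ) → ℂ}, tsupport σ ⊆ O → z ∉ O → ∀ j, dbarCoord n σ j z = 0 :=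
    fun hσ hz j => dbarCoord_eq_zero_of_notMem_tsupport (fun h => hz (hσ h)) j
  have hη0 : ∀ z, z ∉ O → η z = 0 := fun z hz => by
    have := image_eq_zero_of_notMem_tsupport fun h => hz (hKO h)
    simpa using this
  have key := cutoff_estimate_of_compact_weight (U := O) hO hV2 hVc hm hm0 hmC
    (h := h) (G := fun j z => cexp ((V z : ℂ) / 2) * t j z) (η := η) ?_ hh ?_ ?_ ?_
    ⟨hη.1, hη.2.1, hKO⟩
  · have e1 : ∀ z, (∑ j, ‖cexp ((V z : ℂ) / 2) * t j z‖ ^ 2) * Real.exp (-V z) =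
        ∑ j, ‖t j z‖ ^ 2 := fun z => by
      rw [Finset.sum_mul]
      refine Finset.sum_congr rfl fun j _ => ?_
      have : ‖cexp ((V z : ℂ) / 2)‖ = Real.exp (V z / 2) := by
        rw [Complex.norm_exp]; simp
      rw [norm_mul, this, mul_pow, ← Real.exp_nat_mul, mul_right_comm, ← Real.exp_add]
      ring_nf
      simp
    simp only [mul_assoc, e1] at key ⊢
    refine key.trans_eq ?_
    congr 3
    ext z
    by_cases hz : z ∈ O
    · rw [hVW z hz]
    · simp [hη0 z hz]
  · intro z hz ξ
    rw [hessC_congr (g := W) (eventually_of_mem (hO.mem_nhds hz) hVW)]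
    exact hmW z (hOU hz) ξ
  · intro j
    refine memLp_bdd_mul (ht j) hVm.aestronglyMeasurable (C := Real.exp (D / 2)) fun z => ?_
    rw [Complex.norm_exp]
    refine Real.exp_le_exp.2 ?_
    have := (le_abs_self _).trans (hD z)
    simp only [div_ofNat_re, ofReal_re]
    linarith
  · intro j k σ hσ
    have e : ∀ j k, ∫ z, cexp ((V z : ℂ) / 2) * t j z * dbarCoord n σ k z =
        ∫ z, cexp ((W z : ℂ) / 2) * t j z * dbarCoord n σ k z := fun j k => by
      congr 1
      ext z
      by_cases hz : z ∈ O
      · rw [hVW z hz]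
      · simp [hO0 hσ.2.2 hz]
    rw [e, e]
    exact ha j k σ ⟨hσ.1, hσ.2.1, hσ.2.2.trans hOU⟩
  · intro χ hχ hχc hχO
    rw [← hb χ hχ hχc (hχO.trans hOU)]
    congr 1
    ext z
    refine Finset.sum_congr rfl fun j _ => ?_
    by_cases hz : z ∈ O
    · have : cexp (-(W z : ℂ) / 2) = cexp ((W z : ℂ) / 2) * cexp (-(W z : ℂ)) := by
        rw [← Complex.exp_add]; ring_nf
      rw [hVW z hz, map_mul, ← Complex.exp_conj, map_div₀, Complex.conj_ofReal, map_ofNat, this]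
      ring
    · simp [hO0 hχO hz]

end Localization

section Projection

open Filter Topology
open scoped ComplexConjugate

lemma exists_inner_eq_of_forall_inner_eq_zero {E ι : Type*} [NormedAddCommGroup E]
    [InnerProductSpace ℂ E] [CompleteSpace E] (s : ι → E) (g : E) :
    ∃ t, (∀ i, inner ℂ (s i) t = 0) ∧
      ∀ v, (∀ i, inner ℂ (s i) v = 0) → inner ℂ v t = inner ℂ v g := by
  set K := (Submodule.span ℂ (range s))ᗮ with hK
  have hmem : ∀ v, v ∈ K ↔ ∀ i, inner ℂ (s i) v = 0 := by
    intro v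
    rw [hK, Submodule.mem_orthogonal]
    refine ⟨fun h i => h _ (Submodule.subset_span ⟨i, rfl⟩), fun h u hu => ?_⟩
    induction hu using Submodule.span_induction with
    | mem x hx => obtain ⟨i, rfl⟩ := hx; exact h i
    | zero => simp
    | add x y _ _ hx hy => rw [inner_add_left, hx, hy, add_zero]
    | smul a x _ hx => rw [inner_smul_left, hx, mul_zero]
  refine ⟨K.starProjection g, (hmem _).1 (Submodule.starProjection_apply_mem _ _), fun v hv => ?_⟩
  have := (Submodule.mem_orthogonal _ _).1 (K.sub_starProjection_mem_orthogonal g) v ((hmem v).2 hv)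
  rw [inner_sub_right, sub_eq_zero] at this
  exact this.symm

section L2

variable {X : Type*} [MeasurableSpace X] {μ : Measure X} {n : ℕ}

lemma inner_toLp_pi {f g : Fin n → X → ℂ} (hf : ∀ j, MemLp (f j) 2 μ) (hg : ∀ j, MemLp (g j) 2 μ) :
    inner ℂ (WithLp.toLp 2 fun j => (hf j).toLp (f j) : PiLp 2 fun _ : Fin n => Lp ℂ 2 μ)
      (WithLp.toLp 2 fun j => (hg j).toLp (g j)) = ∑ j, ∫ x, conj (f j x) * g j x ∂μ := by
  rw [PiLp.inner_apply]
  refine Finset.sum_congr rfl fun j _ => ?_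
  rw [L2.inner_def]
  refine integral_congr_ae ?_
  filter_upwards [(hf j).coeFn_toLp, (hg j).coeFn_toLp] with x h1 h2
  simp only [h1, h2, RCLike.inner_apply']

lemma norm_sq_toLp_pi {f : Fin n → X → ℂ} (hf : ∀ j, MemLp (f j) 2 μ) :
    ‖(WithLp.toLp 2 fun j => (hf j).toLp (f j) : PiLp 2 fun _ : Fin n => Lp ℂ 2 μ)‖ ^ 2 =
      ∑ j, ∫ x, ‖f j x‖ ^ 2 ∂μ := by
  rw [PiLp.norm_sq_eq_of_L2]
  refine Finset.sum_congr rfl fun j _ => ?_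
  rw [integral_norm_sq_eq (hf j)]
  simp

lemma norm_sum_integral_conj_mul_sq_le {f g : Fin n → X → ℂ} (hf : ∀ j, MemLp (f j) 2 μ)
    (hg : ∀ j, MemLp (g j) 2 μ) :
    ‖∑ j, ∫ x, conj (f j x) * g j x ∂μ‖ ^ 2 ≤
      (∑ j, ∫ x, ‖f j x‖ ^ 2 ∂μ) * ∑ j, ∫ x, ‖g j x‖ ^ 2 ∂μ := by
  rw [← inner_toLp_pi hf hg, ← norm_sq_toLp_pi hf, ← norm_sq_toLp_pi hg, ← mul_pow]
  gcongr
  exact norm_inner_le_norm _ _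

/-- Orthogonal projection onto the annihilator of a family of square-integrable vector fields. -/
lemma exists_orthogonal_projection {ι : Type*} {s : ι → Fin n → X → ℂ}
    (hs : ∀ i j, MemLp (s i j) 2 μ) {g : Fin n → X → ℂ} (hg : ∀ j, MemLp (g j) 2 μ) :
    ∃ t : Fin n → X → ℂ, (∀ j, MemLp (t j) 2 μ) ∧
      (∀ i, ∑ j, ∫ x, conj (s i j x) * t j x ∂μ = 0) ∧
      ∀ v : Fin n → X → ℂ, (∀ j, MemLp (v j) 2 μ) →
        (∀ i, ∑ j, ∫ x, conj (s i j x) * v j x ∂μ = 0) →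
        ∑ j, ∫ x, conj (v j x) * t j x ∂μ = ∑ j, ∫ x, conj (v j x) * g j x ∂μ := by
  obtain ⟨T, hT, hTv⟩ := exists_inner_eq_of_forall_inner_eq_zero
    (fun i => (WithLp.toLp 2 fun j => (hs i j).toLp (s i j) : PiLp 2 fun _ : Fin n => Lp ℂ 2 μ))
    (WithLp.toLp 2 fun j => (hg j).toLp (g j))
  have hTm : ∀ j, MemLp (T j) 2 μ := fun j => Lp.memLp _
  have hTT : (WithLp.toLp 2 fun j => (hTm j).toLp (T j) :
      PiLp 2 fun _ : Fin n => Lp ℂ 2 μ) = T := by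
    ext1 j
    simp
  rw [← hTT] at hT hTv
  refine ⟨fun j => T j, hTm, fun i => ?_, fun v hv hvs => ?_⟩
  · rw [← inner_toLp_pi (hs i) hTm]
    exact hT i
  · rw [← inner_toLp_pi hv hTm, ← inner_toLp_pi hv hg]
    refine hTv _ fun i => ?_
    rw [inner_toLp_pi]
    exact hvs i

end L2

variable {n : ℕ} {U : Set (Fin n → ℂ)}

lemma sum_integral_sub_single_mul {D₁ D₂ : (Fin n → ℂ) → ℂ} {v : Fin n → (Fin n → ℂ) → ℂ}
    (j k : Fin n) (h₁ : ∀ l, Integrable fun z => D₁ z * v l z)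
    (h₂ : ∀ l, Integrable fun z => D₂ z * v l z) :
    ∑ l, ∫ z, ((if l = j then D₁ z else 0) - if l = k then D₂ z else 0) * v l z =
      (∫ z, D₁ z * v j z) - ∫ z, D₂ z * v k z := by
  have h : ∀ l, ∫ z, ((if l = j then D₁ z else 0) - if l = k then D₂ z else 0) * v l z =
      (if l = j then ∫ z, D₁ z * v l z else 0) - if l = k then ∫ z, D₂ z * v l z else 0 := by
    intro l
    split_ifs <;> simp [sub_mul, integral_sub (h₁ l) (h₂ l), integral_neg]
  simp [h, Finset.sum_sub_distrib]

lemma continuous_cexp_mul {W : (Fin n → ℂ) → ℝ} (hU : IsOpen U) (hW : ContinuousOn W U) (c : ℂ)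
    {σ : (Fin n → ℂ) → ℂ} (hσ : Continuous σ) (hs : tsupport σ ⊆ U) :
    Continuous fun z => cexp (c * W z) * σ z := by
  have h := contDiff_mul_of_tsupport_subset (k := 0) (f := fun z => cexp (c * W z)) hU
    (contDiff_zero.2 hσ) hs (contDiffOn_zero.2 (Complex.continuous_exp.comp_continuousOn
      (continuousOn_const.mul (Complex.continuous_ofReal.comp_continuousOn hW))))
  exact contDiff_zero.1 (by simpa only [mul_comm] using h)

lemma tsupport_dbarCoord_subset (σ : (Fin n → ℂ) → ℂ) (j : Fin n) :
    tsupport (dbarCoord n σ j) ⊆ tsupport σ :=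
  closure_minimal (fun _ hz => by_contra fun h =>
    hz (dbarCoord_eq_zero_of_notMem_tsupport h j)) (isClosed_tsupport _)

lemma IsTest.dbarCoord {σ : (Fin n → ℂ) → ℂ} (hσ : IsTest n U σ) (j : Fin n) :
    IsTest n U (dbarCoord n σ j) :=
  ⟨contDiff_dbarCoord hσ.1 (by simp) j, hasCompactSupport_dbarCoord hσ.2.1 j,
    (tsupport_dbarCoord_subset σ j).trans hσ.2.2⟩

lemma integral_dbarCoord_mul_dbarCoord_comm {χ σ : (Fin n → ℂ) → ℂ} (hχ : ContDiff ℝ 1 χ)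
    (hσ : ContDiff ℝ 2 σ) (hσc : HasCompactSupport σ) (j k : Fin n) :
    ∫ z, dbarCoord n χ j z * dbarCoord n σ k z = ∫ z, dbarCoord n χ k z * dbarCoord n σ j z := by
  have h : ∀ j k, ∫ z, dbarCoord n χ j z * dbarCoord n σ k z =
      -∫ z, χ z * dbarCoord n (dbarCoord n σ k) j z := fun j k => by
    rw [integral_mul_dbarCoord hχ (contDiff_dbarCoord hσ (by norm_num) k)
      (hasCompactSupport_dbarCoord hσc k), neg_neg]
  rw [h, h]
  simp only [dbarCoord_dbarCoord_comm hσ.contDiffAt j k]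

/-- The weighted form attached to a test form, projected onto the closed forms. -/
lemma exists_closed_projection {W : (Fin n → ℂ) → ℝ} (hU : IsOpen U) (hW : ContinuousOn W U)
    {c : ℝ} (hWc : ∀ z ∈ U, c ≤ W z) {τ : Fin n → (Fin n → ℂ) → ℂ} (hτ : ∀ j, IsTest n U (τ j)) :
    ∃ t : Fin n → (Fin n → ℂ) → ℂ, (∀ j, MemLp (t j) 2) ∧
      (∀ j k σ, IsTest n U σ → ∫ z, cexp ((W z : ℂ) / 2) * t j z * dbarCoord n σ k z =
        ∫ z, cexp ((W z : ℂ) / 2) * t k z * dbarCoord n σ j z) ∧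
      (∀ χ, ContDiff ℝ 2 χ → HasCompactSupport χ → tsupport χ ⊆ U →
        ∫ z, ∑ j, conj (t j z) * cexp (-(W z : ℂ) / 2) * dbarCoord n χ j z =
          -∫ z, χ z * ∑ j, dbarCoord n (τ j) j z) ∧
      ∀ α : Fin n → (Fin n → ℂ) → ℂ, (∀ j, MemLp (α j) 2 (volume.restrict U)) →
        DbarClosed n U α → ‖∑ j, ∫ z in U, τ j z * α j z‖ ^ 2 ≤
          (∑ j, ∫ z in U, ‖α j z‖ ^ 2 * Real.exp (-W z)) * ∑ j, ∫ z in U, ‖t j z‖ ^ 2 := by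
  set e : (Fin n → ℂ) → ℂ := fun z => cexp ((1 / 2 : ℂ) * W z) with he
  set e' : (Fin n → ℂ) → ℂ := fun z => cexp ((-1 / 2 : ℂ) * W z) with he'
  have hee : ∀ z, e z * e' z = 1 := fun z => by
    rw [he, he', ← Complex.exp_add]; ring_nf; simp
  have hec : ∀ z, conj (e z) = e z := fun z => by
    simp only [he, ← Complex.exp_conj]; simp [map_ofNat]
  have hec' : ∀ z, conj (e' z) = e' z := fun z => by
    simp only [he', ← Complex.exp_conj]; simp [map_ofNat]
  have hen : ∀ z, ‖e' z‖ ^ 2 = Real.exp (-W z) := fun z => by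
    rw [he', Complex.norm_exp, ← Real.exp_nat_mul]
    simp
    ring_nf
  have d2 : ∀ {σ}, IsTest n U σ → ∀ k, Continuous fun z => e z * dbarCoord n σ k z := fun hσ k =>
    continuous_cexp_mul hU hW _ (hσ.dbarCoord k).1.continuous (hσ.dbarCoord k).2.2
  have d3 : ∀ {σ}, IsTest n U σ → ∀ k, HasCompactSupport fun z => e z * dbarCoord n σ k z :=
    fun hσ k => (hσ.dbarCoord k).2.1.mul_left
  have d4 : ∀ {σ}, IsTest n U σ → ∀ k {f : (Fin n → ℂ) → ℂ}, MemLp f 2 →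
      Integrable fun z => e z * dbarCoord n σ k z * f z := fun hσ k f hf =>
    (integrable_mul_of_hasCompactSupport (hf.locallyIntegrable (by norm_num)) (d2 hσ k)
      (d3 hσ k)).congr (Eventually.of_forall fun z => mul_comm _ _)
  set s : {σ // IsTest n U σ} × Fin n × Fin n → Fin n → (Fin n → ℂ) → ℂ := fun i l z =>
    conj ((if l = i.2.1 then e z * dbarCoord n i.1 i.2.2 z else 0) -
      if l = i.2.2 then e z * dbarCoord n i.1 i.2.1 z else 0) with hs
  have hsm : ∀ i j, MemLp (s i j) 2 := by
    rintro ⟨⟨σ, hσ⟩, j, k⟩ l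
    refine MemLp.star (f := fun z => (if l = j then e z * dbarCoord n σ k z else 0) -
      if l = k then e z * dbarCoord n σ j z else 0) (MemLp.sub ?_ ?_)
    · split_ifs
      · exact (d2 hσ k).memLp_of_hasCompactSupport (d3 hσ k)
      · exact MemLp.zero
    · split_ifs
      · exact (d2 hσ j).memLp_of_hasCompactSupport (d3 hσ j)
      · exact MemLp.zero
  have hsv : ∀ σ (hσ : IsTest n U σ) j k (v : Fin n → (Fin n → ℂ) → ℂ), (∀ j, MemLp (v j) 2) →
      ∑ l, ∫ z, conj (s (⟨σ, hσ⟩, j, k) l z) * v l z =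
        (∫ z, e z * dbarCoord n σ k z * v j z) - ∫ z, e z * dbarCoord n σ j z * v k z := by
    intro σ hσ j k v hv
    simp only [hs, Complex.conj_conj]
    exact sum_integral_sub_single_mul j k (fun l => d4 hσ k (hv l)) fun l => d4 hσ j (hv l)
  have hg : ∀ j, MemLp (fun z => e z * conj (τ j z)) 2 := fun j => by
    have hc : Continuous fun z => conj (τ j z) :=
      Complex.continuous_conj.comp (hτ j).1.continuous
    have hs : Function.support (fun z => conj (τ j z)) = Function.support (τ j) := by
      ext z; simp
    refine (continuous_cexp_mul hU hW _ hc ?_).memLp_of_hasCompactSupport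
      (HasCompactSupport.mul_left ?_)
    · rw [tsupport, hs]; exact (hτ j).2.2
    · exact (hτ j).2.1.comp_left (g := conj) (map_zero _)
  obtain ⟨t, ht, hts, htv⟩ := exists_orthogonal_projection hsm hg
  refine ⟨t, ht, fun j k σ hσ => ?_, fun χ hχ hχc hχU => ?_, fun α hα hαc => ?_⟩
  · have := hts (⟨σ, hσ⟩, j, k)
    rw [hsv σ hσ j k t ht, sub_eq_zero] at this
    convert this using 3 <;> simp only [he] <;> ring_nf
  · have hχd : ∀ j, Continuous (dbarCoord n χ j) := fun j =>
      (contDiff_dbarCoord (k := 0) hχ (by norm_num) j).continuous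
    have hd : ∀ j, Continuous fun z => e' z * dbarCoord n χ j z := fun j =>
      continuous_cexp_mul hU hW _ (hχd j) ((tsupport_dbarCoord_subset χ j).trans hχU)
    have hdc : ∀ j, HasCompactSupport fun z => e' z * dbarCoord n χ j z := fun j =>
      (hasCompactSupport_dbarCoord hχc j).mul_left
    have h := htv (fun j z => e' z * dbarCoord n χ j z)
      (fun j => (hd j).memLp_of_hasCompactSupport (hdc j)) (by
        rintro ⟨⟨σ, hσ⟩, j, k⟩
        rw [hsv σ hσ j k _ fun j => (hd j).memLp_of_hasCompactSupport (hdc j), sub_eq_zero]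
        have h1 : ∀ j k, ∫ z, e z * dbarCoord n σ k z * (e' z * dbarCoord n χ j z) =
            ∫ z, dbarCoord n χ j z * dbarCoord n σ k z := fun j k => by
          congr 1; ext z; linear_combination dbarCoord n σ k z * dbarCoord n χ j z * hee z
        rw [h1, h1]
        exact integral_dbarCoord_mul_dbarCoord_comm (hχ.of_le (by norm_num))
          (hσ.1.of_le two_le_infty) hσ.2.1 j k)
    have h' := congrArg conj h
    simp only [map_sum, ← integral_conj, map_mul, Complex.conj_conj, hec'] at h'
    have i1 : ∀ j, Integrable fun z => conj (t j z) * cexp (-(W z : ℂ) / 2) * dbarCoord n χ j z :=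
      fun j => (integrable_mul_of_hasCompactSupport ((ht j).star.locallyIntegrable (by norm_num))
        (hd j) (hdc j)).congr (Eventually.of_forall fun z => by
          simp only [he', Pi.star_apply, RCLike.star_def]; ring_nf)
    rw [integral_finsetSum _ fun j _ => i1 j]
    have h2 : ∀ j, ∫ z, conj (t j z) * cexp (-(W z : ℂ) / 2) * dbarCoord n χ j z =
        ∫ z, e' z * dbarCoord n χ j z * conj (t j z) := fun j => by
      congr 1; ext z; simp only [he']; ring_nf
    simp only [h2, h', Finset.mul_sum]
    have i3 : ∀ j, Integrable fun z => χ z * dbarCoord n (τ j) j z := fun j =>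
      (hχ.continuous.mul ((hτ j).dbarCoord j).1.continuous).integrable_of_hasCompactSupport
        hχc.mul_right
    rw [integral_finsetSum _ fun j _ => i3 j, ← Finset.sum_neg_distrib]
    refine Finset.sum_congr rfl fun j _ => ?_
    rw [integral_mul_dbarCoord (hχ.of_le (by norm_num)) ((hτ j).1.of_le (by simp)) (hτ j).2.1,
      neg_neg]
    congr 1
    ext z
    rw [hec]
    linear_combination dbarCoord n χ j z * τ j z * hee z
  · have hm : ∀ j, MemLp (fun z => e' z * α j z) 2 (volume.restrict U) := fun j => by
      have hcont : ContinuousOn e' U := Complex.continuous_exp.comp_continuousOn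
        (continuousOn_const.mul (Complex.continuous_ofReal.comp_continuousOn hW))
      refine (hα j).of_le_mul (c := Real.exp (-c / 2))
        ((hcont.aestronglyMeasurable hU.measurableSet).mul (hα j).1)
        (ae_restrict_of_forall_mem hU.measurableSet fun z hz => ?_)
      rw [norm_mul, he', Complex.norm_exp]
      gcongr
      have := hWc z hz
      simp
      linarith
    have hv : ∀ j, MemLp (U.indicator fun z => e' z * α j z) 2 := fun j =>
      (memLp_indicator_iff_restrict hU.measurableSet).2 (hm j)
    have hind : ∀ (f : (Fin n → ℂ) → ℂ) j, ∫ z, f z * U.indicator (fun z => e' z * α j z) z =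
        ∫ z in U, f z * (e' z * α j z) := fun f j => by
      rw [← integral_indicator hU.measurableSet]
      congr 1; ext z
      by_cases hz : z ∈ U <;> simp [hz]
    have hind' : ∀ (f : (Fin n → ℂ) → ℂ) j,
        ∫ z, conj (U.indicator (fun z => e' z * α j z) z) * f z =
        ∫ z in U, conj (e' z * α j z) * f z := fun f j => by
      rw [← integral_indicator hU.measurableSet]
      congr 1; ext z
      by_cases hz : z ∈ U <;> simp [hz]
    have h := htv _ hv (by
        rintro ⟨⟨σ, hσ⟩, j, k⟩
        rw [hsv σ hσ j k _ hv, sub_eq_zero, hind, hind]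
        have h1 : ∀ j k, ∫ z in U, e z * dbarCoord n σ k z * (e' z * α j z) =
            ∫ z in U, α j z * dbarCoord n σ k z := fun j k => by
          congr 1; ext z; linear_combination dbarCoord n σ k z * α j z * hee z
        rw [h1, h1]
        exact hαc j k σ hσ)
    simp only [hind'] at h
    have h3 := norm_sum_integral_conj_mul_sq_le hm fun j => (ht j).restrict U
    rw [h] at h3
    have h4 : ∀ j, ∫ z in U, conj (e' z * α j z) * (e z * conj (τ j z)) =
        conj (∫ z in U, τ j z * α j z) := fun j => by
      rw [← integral_conj]
      congr 1; ext z
      rw [map_mul, map_mul, hec']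
      linear_combination conj (α j z) * conj (τ j z) * hee z
    simp only [h4, ← map_sum, RCLike.norm_conj] at h3
    refine h3.trans_eq ?_
    congr 3
    ext j
    congr 1; ext z
    rw [norm_mul, mul_pow, hen, mul_comm]

end Projection

section Apriori

open Filter Topology
open scoped ComplexConjugate

lemma exists_smooth_step : ∃ θ : ℝ → ℝ, ∃ D, ContDiff ℝ (⊤ : ℕ∞) θ ∧ (∀ x, 0 ≤ θ x ∧ θ x ≤ 1) ∧
    (∀ x < 1 / 2, θ x = 0) ∧ (∀ x ≥ 1, θ x = 1) ∧ (∀ x, |deriv θ x| ≤ D) ∧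
    ∀ x, deriv θ x ≠ 0 → 1 / 2 ≤ x ∧ x ≤ 1 := by
  set θ : ℝ → ℝ := fun x => Real.smoothTransition (2 * x - 1) with hθ
  have hs : ContDiff ℝ (⊤ : ℕ∞) θ :=
    Real.smoothTransition.contDiff.comp ((contDiff_const.mul contDiff_id).sub contDiff_const)
  have h0 : ∀ x < 1 / 2, θ x = 0 := fun x hx =>
    Real.smoothTransition.zero_of_nonpos (by linarith)
  have h1 : ∀ x ≥ 1, θ x = 1 := fun x hx => Real.smoothTransition.one_of_one_le (by linarith)
  have hd : ∀ x, deriv θ x ≠ 0 → 1 / 2 ≤ x ∧ x ≤ 1 := by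
    intro x hx
    refine ⟨le_of_not_gt fun h => hx ?_, le_of_not_gt fun h => hx ?_⟩
    · rw [(eventuallyEq_of_mem (Iio_mem_nhds h) h0 : θ =ᶠ[𝓝 x] fun _ => 0).deriv_eq, deriv_const]
    · rw [(eventuallyEq_of_mem (Ioi_mem_nhds h) fun y hy => h1 y (le_of_lt hy) :
        θ =ᶠ[𝓝 x] fun _ => 1).deriv_eq, deriv_const]
  have hdc : HasCompactSupport (deriv θ) :=
    HasCompactSupport.intro (isCompact_Icc (a := (1 / 2 : ℝ)) (b := 1)) fun x hx => by
      by_contra h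
      exact hx (hd x h)
  obtain ⟨D, hD⟩ := hdc.exists_bound_of_continuous (hs.continuous_deriv (by simp))
  exact ⟨θ, D, hs, fun x => ⟨Real.smoothTransition.nonneg _, Real.smoothTransition.le_one _⟩, h0,
    h1, hD, hd⟩

variable {n : ℕ} {U : Set (Fin n → ℂ)} {s : (Fin n → ℂ) → ℝ} {θ : ℝ → ℝ}

lemma dbarCoord_comp_ofReal {z : Fin n → ℂ} (hθ : Differentiable ℝ θ) (hs : DifferentiableAt ℝ s z)
    (j : Fin n) : dbarCoord n (fun w => (θ (s w) : ℂ)) j z =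
      deriv θ (s z) * dbarCoord n (fun w => (s w : ℂ)) j z := by
  have h : fderiv ℝ (fun w => θ (s w)) z = deriv θ (s z) • fderiv ℝ s z :=
    ((hθ _).hasDerivAt.comp_hasFDerivAt z hs.hasFDerivAt).fderiv
  rw [dbarCoord, dbarCoord, fderiv_ofReal hs,
    fderiv_ofReal (W := fun w => θ (s w)) ((hθ _).comp z hs), h]
  simp
  ring

lemma isTest_indicator_step (hU : IsOpen U) (hs : ContDiffOn ℝ (⊤ : ℕ∞) s U)
    (hsc : ∀ ε > 0, IsCompact {z ∈ U | ε ≤ s z}) (hθ : ContDiff ℝ (⊤ : ℕ∞) θ)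
    (hθ0 : ∀ x < 1 / 2, θ x = 0) {r : ℝ} (hr : 0 < r) :
    IsTest n U fun z => ((U.indicator (fun z => θ (r * s z)) z : ℝ) : ℂ) := by
  set K := {z ∈ U | 1 / (2 * r) ≤ s z} with hK
  have hKc : IsCompact K := hsc _ (by positivity)
  have h0 : ∀ z, z ∉ K → ((U.indicator (fun z => θ (r * s z)) z : ℝ) : ℂ) = 0 := fun z hz => by
    by_cases hzU : z ∈ U
    · have h : s z < 1 / (2 * r) := lt_of_not_ge fun h => hz ⟨hzU, h⟩
      rw [lt_div_iff₀ (by positivity)] at h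
      rw [indicator_of_mem hzU, hθ0 _ (by linarith), ofReal_zero]
    · simp [hzU]
  have hsub : tsupport (fun z => ((U.indicator (fun z => θ (r * s z)) z : ℝ) : ℂ)) ⊆ K :=
    closure_minimal (fun z hz => by_contra fun h => hz (h0 z h)) hKc.isClosed
  refine ⟨contDiff_iff_contDiffAt.2 fun z => ?_,
    hKc.of_isClosed_subset (isClosed_tsupport _) hsub, hsub.trans fun z hz => hz.1⟩
  by_cases hz : z ∈ U
  · have h1 : ContDiffAt ℝ (⊤ : ℕ∞) (fun z => θ (r * s z)) z :=
      hθ.contDiffAt.comp z (contDiffAt_const.mul (hs.contDiffAt (hU.mem_nhds hz)))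
    refine (contDiffAt_ofReal h1).congr_of_eventuallyEq ?_
    filter_upwards [hU.mem_nhds hz] with w hw
    rw [indicator_of_mem hw]
  · refine (contDiffAt_const (c := 0)).congr_of_eventuallyEq ?_
    filter_upwards [hKc.isClosed.isOpen_compl.mem_nhds fun h => hz h.1] with w hw
    exact h0 w hw

lemma sum_norm_dbarCoord_indicator_step_sq_le (hU : IsOpen U) (hs : ContDiffOn ℝ (⊤ : ℕ∞) s U)
    (hsc : ∀ ε > 0, IsCompact {z ∈ U | ε ≤ s z}) (hθ : ContDiff ℝ (⊤ : ℕ∞) θ)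
    (hθ0 : ∀ x < 1 / 2, θ x = 0) {D : ℝ} (hD : ∀ x, |deriv θ x| ≤ D)
    (hθd : ∀ x, deriv θ x ≠ 0 → 1 / 2 ≤ x ∧ x ≤ 1) {Q : ℝ}
    (hQ : ∀ z ∈ U, ∑ j, ‖dbarCoord n (fun w => (s w : ℂ)) j z‖ ^ 2 ≤ Q) {r : ℝ} (hr : 0 < r)
    (z : Fin n → ℂ) :
    ∑ j, ‖dbarCoord n (fun z => ((U.indicator (fun z => θ (r * s z)) z : ℝ) : ℂ)) j z‖ ^ 2 ≤
      {z ∈ U | 1 / (2 * r) ≤ s z ∧ s z ≤ 1 / r}.indicator (fun _ => D ^ 2 * Q * r ^ 2) z := by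
  by_cases hz : z ∈ U
  · have hsz := (hs.contDiffAt (hU.mem_nhds hz)).differentiableAt (by simp)
    have hθ' : Differentiable ℝ fun x => θ (r * x) :=
      (hθ.differentiable (by simp)).comp (differentiable_id.const_mul r)
    have e : ∀ j, dbarCoord n (fun z => ((U.indicator (fun z => θ (r * s z)) z : ℝ) : ℂ)) j z =
        r * deriv θ (r * s z) * dbarCoord n (fun w => (s w : ℂ)) j z := fun j => by
      rw [dbarCoord_congr (g := fun z => (θ (r * s z) : ℂ)),
        dbarCoord_comp_ofReal hθ' hsz, deriv_comp_mul_left]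
      · simp
      · filter_upwards [hU.mem_nhds hz] with w hw
        rw [indicator_of_mem hw]
    simp only [e, norm_mul, mul_pow, ← Finset.mul_sum, Complex.norm_real, Real.norm_eq_abs, sq_abs]
    by_cases hd : deriv θ (r * s z) = 0
    · rw [hd]
      have : 0 ≤ Q := le_trans (by positivity) (hQ z hz)
      simpa using indicator_nonneg (fun _ _ => by positivity) z
    · obtain ⟨h1, h2⟩ := hθd _ hd
      rw [indicator_of_mem]
      · have h3 : deriv θ (r * s z) ^ 2 ≤ D ^ 2 := by
          rw [← sq_abs]; exact pow_le_pow_left₀ (abs_nonneg _) (hD _) 2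
        calc r ^ 2 * deriv θ (r * s z) ^ 2 * ∑ j, ‖dbarCoord n (fun w => (s w : ℂ)) j z‖ ^ 2
            ≤ r ^ 2 * D ^ 2 * Q := by
              refine mul_le_mul (by gcongr) (hQ z hz) (by positivity) (by positivity)
          _ = _ := by ring
      · refine ⟨hz, ?_, ?_⟩
        · rw [div_le_iff₀ (by positivity)]; linarith
        · rw [le_div_iff₀ hr]; linarith
  · have ht := (isTest_indicator_step hU hs hsc hθ hθ0 hr).2.2
    have h0 : ∀ j,
        dbarCoord n (fun z => ((U.indicator (fun z => θ (r * s z)) z : ℝ) : ℂ)) j z = 0 :=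
      fun j => dbarCoord_eq_zero_of_notMem_tsupport (fun h => hz (ht h)) j
    rw [indicator_of_notMem fun h => hz h.1]
    simp [h0]

/-- A weight blowing up at the boundary fast enough makes the cut-off terms negligible. -/
lemma apriori_estimate {W : (Fin n → ℂ) → ℝ} (hU : IsOpen U) (hs : ContDiffOn ℝ (⊤ : ℕ∞) s U)
    (hs0 : ∀ z ∈ U, 0 < s z) (hsc : ∀ ε > 0, IsCompact {z ∈ U | ε ≤ s z}) {Q : ℝ}
    (hQ : ∀ z ∈ U, ∑ j, ‖dbarCoord n (fun w => (s w : ℂ)) j z‖ ^ 2 ≤ Q)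
    (hW : ContDiffOn ℝ 2 W U) {B : ℝ} (hB : 0 ≤ B)
    (hQ0 : 0 ≤ Q) (hHW : ∀ z ∈ U, ∀ ξ, (B + 4 / s z ^ 5) * enormSq n ξ ≤ hessC n W z ξ)
    {h : (Fin n → ℂ) → ℂ} {t : Fin n → (Fin n → ℂ) → ℂ} (hh : Continuous h)
    (hhc : HasCompactSupport h) (hhU : tsupport h ⊆ U) (ht : ∀ j, MemLp (t j) 2)
    (ha : ∀ j k σ, IsTest n U σ → ∫ z, cexp ((W z : ℂ) / 2) * t j z * dbarCoord n σ k z =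
      ∫ z, cexp ((W z : ℂ) / 2) * t k z * dbarCoord n σ j z)
    (hb : ∀ χ, ContDiff ℝ 2 χ → HasCompactSupport χ → tsupport χ ⊆ U →
      ∫ z, ∑ j, conj (t j z) * cexp (-(W z : ℂ) / 2) * dbarCoord n χ j z = -∫ z, χ z * h z) :
    B * ∑ j, ∫ z in U, ‖t j z‖ ^ 2 ≤ 2 * ∫ z, ‖h z‖ ^ 2 * Real.exp (W z) := by
  obtain ⟨θ, D, hθ, hθ01, hθ0, hθ1, hD, hθd⟩ := exists_smooth_step
  have hn : ∀ ξ : Fin n → ℂ, 0 ≤ enormSq n ξ := fun ξ =>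
    Finset.sum_nonneg fun j _ => Complex.normSq_nonneg _
  set η : ℝ → (Fin n → ℂ) → ℝ := fun r => U.indicator fun z => θ (r * s z) with hη
  have hη01 : ∀ r z, 0 ≤ η r z ∧ η r z ≤ 1 := fun r z => by
    by_cases hz : z ∈ U <;> simp [hη, hz, hθ01]
  have hηt : ∀ r > 0, IsTest n U fun z => (η r z : ℂ) := fun r hr =>
    isTest_indicator_step hU hs hsc hθ hθ0 hr
  set T : (Fin n → ℂ) → ℝ := fun z => ∑ j, ‖t j z‖ ^ 2 with hT
  have hT0 : ∀ z, 0 ≤ T z := fun z => by positivity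
  have hTi : Integrable T := integrable_finsetSum _ fun j _ => (ht j).integrable_norm_pow (by simp)
  set E : ℝ → Set (Fin n → ℂ) := fun r => {z ∈ U | 1 / (2 * r) ≤ s z ∧ s z ≤ 1 / r} with hE
  have hEm : ∀ r > 0, MeasurableSet (E r) := fun r hr => by
    have h1 : E r = {z ∈ U | 1 / (2 * r) ≤ s z} \ (U ∩ s ⁻¹' Ioi (1 / r)) := by
      ext z
      simp only [hE, mem_ofPred_eq, Set.mem_sdiff, mem_inter_iff, mem_preimage, mem_Ioi, not_and,
        not_lt]
      tauto
    rw [h1]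
    exact (hsc _ (by positivity)).measurableSet.diff
      (hs.continuousOn.isOpen_inter_preimage hU isOpen_Ioi).measurableSet
  set N := ∫ z, ‖h z‖ ^ 2 * Real.exp (W z) with hN
  set A : ℝ → ℝ := fun r => ∫ z in E r, T z with hA
  set M := ∫ z, T z with hM
  have hAM : ∀ r, A r ≤ M := fun r =>
    setIntegral_le_integral hTi (Eventually.of_forall hT0)
  have iN : Integrable fun z => ‖h z‖ ^ 2 * Real.exp (W z) := by
    have hsub : tsupport (fun z => ‖h z‖ ^ 2) ⊆ tsupport h :=
      closure_mono fun z hz => by simpa using hz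
    refine Continuous.integrable_of_hasCompactSupport (contDiff_zero.1 <|
      contDiff_mul_of_tsupport_subset (k := 0) hU (contDiff_zero.2 (hh.norm.pow 2))
        (hsub.trans hhU) (contDiffOn_zero.2 hW.continuousOn.rexp)) ?_
    exact HasCompactSupport.mul_right (hhc.of_isClosed_subset (isClosed_tsupport _) hsub)
  have hDQ : 0 ≤ D ^ 2 * Q := by positivity
  have hN0 : 0 ≤ N := integral_nonneg fun z => by positivity
  have hM0 : 0 ≤ M := integral_nonneg hT0
  have hA0 : ∀ r, 0 ≤ A r := fun r => integral_nonneg hT0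
  have main : ∀ r > 0, ∀ m : (Fin n → ℂ) → ℝ, Measurable m → (∀ z, 0 ≤ m z) →
      (∃ C, ∀ z, m z ≤ C) → (∀ z ∈ U, m z ≤ B + 4 / s z ^ 5) →
      ∫ z, m z * η r z ^ 2 * T z ≤ 2 * N + 4 * (D ^ 2 * Q * r ^ 2 * A r) := by
    rintro r hr m hm hm0 ⟨C, hmC⟩ hmW
    refine (cutoff_estimate hU hW hm hm0 hmC (fun z hz ξ => le_trans
      (mul_le_mul_of_nonneg_right (hmW z hz) (hn ξ)) (hHW z hz ξ)) hh ht ha hb (hηt r hr)).trans ?_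
    refine add_le_add ?_ ?_
    · refine mul_le_mul_of_nonneg_left (integral_mono_of_nonneg (Eventually.of_forall fun z => by
        positivity) iN (Eventually.of_forall fun z => ?_)) (by norm_num)
      have := pow_le_one₀ (n := 2) (hη01 r z).1 (hη01 r z).2
      have h2 : 0 ≤ ‖h z‖ ^ 2 * Real.exp (W z) := by positivity
      simp only [mul_assoc]
      exact mul_le_of_le_one_left h2 this
    · refine mul_le_mul_of_nonneg_left ?_ (by norm_num)
      rw [hA, ← integral_const_mul, ← integral_indicator (hEm r hr)]
      refine integral_mono_of_nonneg (Eventually.of_forall fun z => by positivity)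
        ((hTi.const_mul _).indicator (hEm r hr)) (Eventually.of_forall fun z => ?_)
      have := mul_le_mul_of_nonneg_right (sum_norm_dbarCoord_indicator_step_sq_le hU hs hsc hθ hθ0
        hD hθd hQ hr z) (hT0 z)
      refine this.trans_eq ?_
      by_cases hz : z ∈ E r
      · rw [indicator_of_mem hz, indicator_of_mem hz]
      · rw [indicator_of_notMem hz, indicator_of_notMem hz, zero_mul]
  have hAr : ∀ r > 0, 4 * r ^ 5 * A r ≤ 2 * N + 4 * (D ^ 2 * Q * (2 * r) ^ 2 * M) := by
    intro r hr
    have h1 := main (2 * r) (by positivity) ((E r).indicator fun _ => 4 * r ^ 5)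
      (measurable_const.indicator (hEm r hr))
      (fun z => indicator_nonneg (fun _ _ => by positivity) z)
      ⟨4 * r ^ 5, fun z => indicator_le_self' (fun _ _ => by positivity) z⟩ fun z hz => ?_
    · refine le_trans (le_of_eq ?_) (h1.trans ?_)
      · rw [hA, ← integral_const_mul, ← integral_indicator (hEm r hr)]
        congr 1; ext z
        by_cases hz : z ∈ E r
        · have h2 : 1 ≤ 2 * r * s z := by
            have := hz.2.1
            rw [div_le_iff₀ (by positivity)] at this
            linarith
          rw [indicator_of_mem hz, indicator_of_mem hz, hη]
          simp only [indicator_of_mem hz.1, hθ1 _ h2]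
          ring
        · simp [hz]
      · have := mul_le_mul_of_nonneg_left (hAM (2 * r))
          (mul_nonneg hDQ (sq_nonneg (2 * r)))
        linarith
    · by_cases hzE : z ∈ E r
      · rw [indicator_of_mem hzE]
        have h2 : s z * r ≤ 1 := (le_div_iff₀ hr).1 hzE.2.2
        have h3 := hs0 z hz
        have h4 : 4 * r ^ 5 ≤ 4 / s z ^ 5 := by
          rw [le_div_iff₀ (by positivity), mul_assoc, ← mul_pow, mul_comm r]
          have := pow_le_one₀ (n := 5) (by positivity) h2
          linarith
        linarith
      · rw [indicator_of_notMem hzE]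
        have := hs0 z hz
        positivity
  have hlim1 : Tendsto (fun k : ℕ => ∫ z, B * η k z ^ 2 * T z) atTop
      (𝓝 (B * ∑ j, ∫ z in U, ‖t j z‖ ^ 2)) := by
    have e : B * ∑ j, ∫ z in U, ‖t j z‖ ^ 2 = ∫ z, U.indicator (fun z => B * T z) z := by
      rw [integral_indicator hU.measurableSet, integral_const_mul, hT,
        integral_finsetSum _ fun j _ => ((ht j).integrable_norm_pow (by simp)).integrableOn]
    rw [e]
    refine tendsto_integral_of_dominated_convergence (fun z => B * T z) (fun k => ?_)
      (hTi.const_mul B) (fun k => Eventually.of_forall fun z => ?_)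
      (Eventually.of_forall fun z => ?_)
    · have h2 : AEStronglyMeasurable (η k) := (aestronglyMeasurable_indicator_iff
        hU.measurableSet).2 ((hθ.continuous.comp_continuousOn
          (continuousOn_const.mul hs.continuousOn)).aestronglyMeasurable hU.measurableSet)
      exact ((h2.pow 2).const_mul B).mul hTi.1
    · have h2 : η k z ^ 2 ≤ 1 := pow_le_one₀ (hη01 k z).1 (hη01 k z).2
      have h3 : 0 ≤ B * T z := mul_nonneg hB (hT0 z)
      have h4 : B * η k z ^ 2 * T z = η k z ^ 2 * (B * T z) := by ring
      rw [Real.norm_eq_abs, h4, abs_of_nonneg (by positivity)]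
      exact mul_le_of_le_one_left h3 h2
    · by_cases hz : z ∈ U
      · refine tendsto_const_nhds.congr' ?_
        filter_upwards [eventually_ge_atTop ⌈1 / s z⌉₊] with k hk
        have h2 : 1 ≤ k * s z := by
          rw [← div_le_iff₀ (hs0 z hz)]
          exact Nat.ceil_le.1 hk
        rw [indicator_of_mem hz, hη]
        simp only [indicator_of_mem hz, hθ1 _ h2]
        ring
      · simp [hη, hz]
  have hlim2 : Tendsto (fun k : ℕ => 2 * N + 4 * (D ^ 2 * Q * k ^ 2 * A k)) atTop
      (𝓝 (2 * N + 4 * 0)) := by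
    set c := 16 * D ^ 2 * Q * M with hc
    have hc0 : 0 ≤ c := by positivity
    have hlim := (tendsto_const_div_atTop_nhds_zero_nat ((2 * N + c) / 4)).const_mul (D ^ 2 * Q)
    rw [mul_zero] at hlim
    refine tendsto_const_nhds.add (Tendsto.const_mul 4 (squeeze_zero' (Eventually.of_forall
      fun k => mul_nonneg (mul_nonneg hDQ (sq_nonneg _)) (hA0 _)) ?_ hlim))
    filter_upwards [eventually_ge_atTop 1] with k hk
    have hk1 : (1 : ℝ) ≤ k := by exact_mod_cast hk
    rw [mul_assoc]
    refine mul_le_mul_of_nonneg_left ?_ hDQ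
    rw [le_div_iff₀ (by positivity)]
    have h1 := hAr k (by positivity)
    have h2 : 2 * N + c * k ^ 2 ≤ (2 * N + c) * k ^ 2 := by
      have := mul_le_mul_of_nonneg_left (one_le_pow₀ hk1 (n := 2)) hN0
      linarith
    have h3 : k ^ 2 * (4 * (k ^ 2 * A k * k)) ≤ k ^ 2 * (2 * N + c) := by
      calc k ^ 2 * (4 * (k ^ 2 * A k * k)) = 4 * k ^ 5 * A k := by ring
        _ ≤ 2 * N + c * k ^ 2 := h1.trans_eq (by rw [hc]; ring)
        _ ≤ _ := h2.trans_eq (mul_comm _ _)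
    have h4 := le_of_mul_le_mul_left h3 (by positivity)
    linarith
  rw [mul_zero, add_zero] at hlim2
  refine le_of_tendsto_of_tendsto hlim1 hlim2 ?_
  filter_upwards [eventually_gt_atTop 0] with k hk
  refine main k (by exact_mod_cast hk) (fun _ => B) measurable_const (fun _ => hB)
    ⟨B, fun _ => le_rfl⟩
    fun z hz => ?_
  have := hs0 z hz
  have : 0 ≤ 4 / s z ^ 5 := by positivity
  linarith

end Apriori

section Weight

open Filter Topology
open scoped ComplexConjugate

lemma iteratedFDeriv_two_comp {E : Type*} [NormedAddCommGroup E] [NormedSpace ℝ E] {s : E → ℝ}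
    {z : E} {g g₁ : ℝ → ℝ} {g₂ : ℝ} (hs : ContDiffAt ℝ 2 s z)
    (hg : ∀ᶠ x in 𝓝 (s z), HasDerivAt g (g₁ x) x) (hg₁ : HasDerivAt g₁ g₂ (s z)) (v : E) :
    iteratedFDeriv ℝ 2 (fun w => g (s w)) z ![v, v] =
      g₁ (s z) * iteratedFDeriv ℝ 2 s z ![v, v] + g₂ * fderiv ℝ s z v ^ 2 := by
  have h1 : fderiv ℝ (fun w => g (s w)) =ᶠ[𝓝 z] fun w => g₁ (s w) • fderiv ℝ s w := by
    filter_upwards [hs.continuousAt.eventually hg,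
      hs.eventually (by simp)] with w hw hw2
    exact (hw.comp_hasFDerivAt w (hw2.differentiableAt (by norm_num)).hasFDerivAt).fderiv
  have h2 : DifferentiableAt ℝ (fderiv ℝ s) z :=
    (hs.fderiv_right (m := 1) (by norm_num)).differentiableAt (by norm_num)
  have h3 := (hg₁.comp_hasFDerivAt z (hs.differentiableAt (by norm_num)).hasFDerivAt)
  have h4 : HasFDerivAt (fun w => g₁ (s w) • fderiv ℝ s w) _ z := h3.smul h2.hasFDerivAt
  rw [iteratedFDeriv_two_apply, iteratedFDeriv_two_apply, h1.fderiv_eq, h4.fderiv]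
  simp
  ring

variable {n : ℕ}

lemma hessC_add {f g : (Fin n → ℂ) → ℝ} {z : Fin n → ℂ} (hf : ContDiffAt ℝ 2 f z)
    (hg : ContDiffAt ℝ 2 g z) (ξ : Fin n → ℂ) :
    hessC n (fun w => f w + g w) z ξ = hessC n f z ξ + hessC n g z ξ := by
  have h : iteratedFDeriv ℝ 2 (fun w => f w + g w) z = _ := iteratedFDeriv_add_apply hf hg
  simp only [hessC, h]
  simp
  ring

lemma contDiff_enormSq {k : WithTop ℕ∞} : ContDiff ℝ k (enormSq n) := by
  have : enormSq n = fun z => ∑ j, ‖z j‖ ^ 2 := funext enormSq_eq_sum_norm_sq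
  rw [this]
  exact ContDiff.sum fun j _ => (contDiff_apply ℝ ℂ j).norm_sq ℝ

lemma hessC_enormSq (z ξ : Fin n → ℂ) : hessC n (enormSq n) z ξ = enormSq n ξ := by
  have h1 : ∀ w, HasFDerivAt (enormSq n) (∑ j, 2 • (innerSL ℝ (w j)).comp
      (ContinuousLinearMap.proj j : (Fin n → ℂ) →L[ℝ] ℂ)) w := fun w => by
    have : enormSq n = fun z => ∑ j, ‖z j‖ ^ 2 := funext enormSq_eq_sum_norm_sq
    rw [this]
    exact HasFDerivAt.fun_sum fun j _ => (hasFDerivAt_apply j w).norm_sq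
  have h2 : ∀ v, iteratedFDeriv ℝ 2 (enormSq n) z ![v, v] = 2 * enormSq n v := fun v => by
    have h3 : HasFDerivAt (fun w => fderiv ℝ (enormSq n) w v) (∑ j, 2 • (innerSL ℝ (v j)).comp
      (ContinuousLinearMap.proj j : (Fin n → ℂ) →L[ℝ] ℂ)) z := by
      have : (fun w => fderiv ℝ (enormSq n) w v) = ⇑(∑ j, 2 • (innerSL ℝ (v j)).comp
          (ContinuousLinearMap.proj j : (Fin n → ℂ) →L[ℝ] ℂ)) := by
        ext w
        rw [(h1 w).fderiv]
        simp [real_inner_comm]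
      rw [this]
      exact ContinuousLinearMap.hasFDerivAt _
    have h4 : DifferentiableAt ℝ (fderiv ℝ (enormSq n)) z :=
      ((contDiff_enormSq (k := 2)).contDiffAt.fderiv_right (m := 1)
        (by norm_num)).differentiableAt (by norm_num)
    rw [iteratedFDeriv_two_apply]
    have h5 := h4.hasFDerivAt.clm_apply (hasFDerivAt_const v z)
    have h6 := congrArg (fun L => L v) (h5.unique h3)
    simp at h6
    simp [h6, enormSq_eq_sum_norm_sq, Finset.mul_sum]
  rw [hessC, h2, h2]
  have : enormSq n (I • ξ) = enormSq n ξ := by simp [enormSq_eq_sum_norm_sq]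
  rw [this]
  ring

/-- The Hessian of `φ + (a - Ψ)⁻⁴`. -/
lemma le_hessC_add_inv_pow {φ Ψ : (Fin n → ℂ) → ℝ} {z : Fin n → ℂ} (hφ : ContDiffAt ℝ 2 φ z)
    (hΨ : ContDiffAt ℝ 2 Ψ z) {a : ℝ} (ha : Ψ z < a) {B : ℝ} {ξ : Fin n → ℂ}
    (hHφ : B * enormSq n ξ ≤ hessC n φ z ξ) (hHΨ : enormSq n ξ ≤ hessC n Ψ z ξ) :
    (B + 4 / (a - Ψ z) ^ 5) * enormSq n ξ ≤
      hessC n (fun w => φ w + ((a - Ψ w) ^ 4)⁻¹) z ξ := by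
  have hpos : 0 < a - Ψ z := sub_pos.2 ha
  have hd : ∀ (k : ℕ) (x : ℝ), x < a →
      HasDerivAt (fun x => ((a - x) ^ (k + 1))⁻¹) ((k + 1) * ((a - x) ^ (k + 2))⁻¹) x := by
    intro k x hx
    have hx' : a - x ≠ 0 := (sub_pos.2 hx).ne'
    have := (((hasDerivAt_id x).const_sub a).pow (k + 1)).inv (pow_ne_zero _ hx')
    refine this.congr_deriv ?_
    simp
    field_simp
    ring
  have hg : ∀ᶠ x in 𝓝 (Ψ z), HasDerivAt (fun x => ((a - x) ^ 4)⁻¹) (4 * ((a - x) ^ 5)⁻¹) x := by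
    filter_upwards [Iio_mem_nhds ha] with x hx
    have := hd 3 x hx
    norm_num at this
    exact this
  have hg1 : HasDerivAt (fun x => 4 * ((a - x) ^ 5)⁻¹) (20 * ((a - Ψ z) ^ 6)⁻¹) (Ψ z) := by
    have := (hd 4 _ ha).const_mul 4
    norm_num [← mul_assoc] at this
    exact this
  have hc : ContDiffAt ℝ 2 (fun w => ((a - Ψ w) ^ 4)⁻¹) z :=
    ((contDiffAt_const.sub hΨ).pow 4).inv (pow_ne_zero _ hpos.ne')
  rw [hessC_add hφ hc, add_mul]
  refine add_le_add hHφ ?_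
  have h := iteratedFDeriv_two_comp hΨ hg hg1
  rw [hessC, h, h]
  have h1 : 4 / (a - Ψ z) ^ 5 * enormSq n ξ ≤ 4 / (a - Ψ z) ^ 5 * hessC n Ψ z ξ :=
    mul_le_mul_of_nonneg_left hHΨ (by positivity)
  have h2 : 0 ≤ 20 * ((a - Ψ z) ^ 6)⁻¹ * (fderiv ℝ Ψ z ξ ^ 2 + fderiv ℝ Ψ z (I • ξ) ^ 2) := by
    positivity
  refine h1.trans ?_
  rw [hessC, div_eq_mul_inv]
  linarith

end Weight

section ClosedForms

open Filter Topology
open scoped ComplexConjugate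

variable {n : ℕ} {Ω : Set (Fin n → ℂ)}

lemma continuousOn_dbarCoord {f : (Fin n → ℂ) → ℂ} (hΩ : IsOpen Ω) (hf : ContDiffOn ℝ 1 f Ω)
    (j : Fin n) : ContinuousOn (dbarCoord n f j) Ω := by
  have h := hf.continuousOn_fderiv_of_isOpen hΩ le_rfl
  have h' : ∀ v, ContinuousOn (fun z => fderiv ℝ f z v) Ω := fun v =>
    h.clm_apply continuousOn_const
  exact continuousOn_const.mul ((h' _).add (continuousOn_const.mul (h' _)))

lemma IsTest.mono {U : Set (Fin n → ℂ)} {σ : (Fin n → ℂ) → ℂ} (hσ : IsTest n U σ) (h : U ⊆ Ω) :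
    IsTest n Ω σ :=
  ⟨hσ.1, hσ.2.1, hσ.2.2.trans h⟩

lemma setIntegral_mul_eq_of_tsupport_subset {U : Set (Fin n → ℂ)} (h : U ⊆ Ω)
    {f σ : (Fin n → ℂ) → ℂ} (hΩ : MeasurableSet Ω) (hσ : tsupport σ ⊆ U) :
    ∫ z in U, f z * σ z = ∫ z in Ω, f z * σ z :=
  (setIntegral_eq_of_subset_of_forall_sdiff_eq_zero hΩ h fun z hz => by
    rw [image_eq_zero_of_notMem_tsupport fun hz' => hz.2 (hσ hz'), mul_zero]).symm

lemma DbarClosed.mono {U : Set (Fin n → ℂ)} {α : Fin n → (Fin n → ℂ) → ℂ} (h : U ⊆ Ω)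
    (hΩ : MeasurableSet Ω) (hα : DbarClosed n Ω α) : DbarClosed n U α := fun j k σ hσ => by
  rw [setIntegral_mul_eq_of_tsupport_subset h hΩ ((tsupport_dbarCoord_subset σ k).trans hσ.2.2),
    setIntegral_mul_eq_of_tsupport_subset h hΩ ((tsupport_dbarCoord_subset σ j).trans hσ.2.2)]
  exact hα j k σ (hσ.mono h)

variable {φ Ψ : (Fin n → ℂ) → ℝ} {A B : ℝ}

lemma norm_sum_integral_test_mul_sq_le_of_lt (hΩ : IsOpen Ω) (hφ : ContDiffOn ℝ 2 φ Ω) (hB : 0 < B)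
    (hbd : ∀ z ∈ Ω, |φ z| ≤ A) (hHφ : ∀ z ∈ Ω, ∀ ξ, B * enormSq n ξ ≤ hessC n φ z ξ)
    (hΨ : ContDiffOn ℝ (⊤ : ℕ∞) Ψ Ω) (hHΨ : ∀ z ∈ Ω, ∀ ξ, enormSq n ξ ≤ hessC n Ψ z ξ)
    (hex : ∀ c, IsCompact {z ∈ Ω | Ψ z ≤ c}) {τ : Fin n → (Fin n → ℂ) → ℂ}
    (hτ : ∀ j, IsTest n Ω (τ j)) {a₀ a : ℝ}
    (hτa : ∀ j, ∀ z ∈ tsupport (τ j), Ψ z ≤ a₀) (ha : a₀ < a)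
    {α : Fin n → (Fin n → ℂ) → ℂ} (hα : ∀ j, MemLp (α j) 2 (volume.restrict Ω))
    (hαc : DbarClosed n Ω α) :
    ‖∑ j, ∫ z in Ω, τ j z * α j z‖ ^ 2 ≤ 2 / B * Real.exp (2 * A + ((a - a₀) ^ 4)⁻¹) *
      (∑ j, ∫ z in Ω, ‖α j z‖ ^ 2) * ∫ z, ‖∑ j, dbarCoord n (τ j) j z‖ ^ 2 := by
  set U := Ω ∩ Ψ ⁻¹' Iio a with hUdef
  have hU : IsOpen U := hΨ.continuousOn.isOpen_inter_preimage hΩ isOpen_Iio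
  have hUΩ : U ⊆ Ω := inter_subset_left
  have hUa : ∀ z ∈ U, Ψ z < a := fun z hz => hz.2
  set W : (Fin n → ℂ) → ℝ := fun z => φ z + ((a - Ψ z) ^ 4)⁻¹ with hWdef
  have hW : ContDiffOn ℝ 2 W U := (hφ.mono hUΩ).add
    (((contDiffOn_const.sub ((hΨ.of_le two_le_infty).mono hUΩ)).pow 4).inv
      fun z hz => pow_ne_zero _ (sub_pos.2 (hUa z hz)).ne')
  have hWA : ∀ z ∈ U, -A ≤ W z := fun z hz => by
    have h1 := (abs_le.1 (hbd z (hUΩ hz))).1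
    have h2 : 0 ≤ ((a - Ψ z) ^ 4)⁻¹ := by positivity
    simp only [hWdef]; linarith
  have hτU : ∀ j, IsTest n U (τ j) := fun j => ⟨(hτ j).1, (hτ j).2.1, fun z hz =>
    ⟨(hτ j).2.2 hz, (hτa j z hz).trans_lt ha⟩⟩
  set h : (Fin n → ℂ) → ℂ := fun z => ∑ j, dbarCoord n (τ j) j z with hh
  have hhc : Continuous h := continuous_finsetSum _ fun j _ => ((hτ j).dbarCoord j).1.continuous
  have hh0 : ∀ z, z ∉ ⋃ j, tsupport (τ j) → h z = 0 := fun z hz => by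
    refine Finset.sum_eq_zero fun j _ => dbarCoord_eq_zero_of_notMem_tsupport ?_ j
    exact fun h => hz (mem_iUnion.2 ⟨j, h⟩)
  have hK : IsCompact (⋃ j, tsupport (τ j)) := isCompact_iUnion fun j => (hτ j).2.1
  have hhK : tsupport h ⊆ ⋃ j, tsupport (τ j) :=
    closure_minimal (fun z hz => by_contra fun h => hz (hh0 z h)) hK.isClosed
  have hhs : HasCompactSupport h := hK.of_isClosed_subset (isClosed_tsupport _) hhK
  obtain ⟨t, ht, hta, htb, htc⟩ := exists_closed_projection hU hW.continuousOn hWA hτU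
  have hsc : ∀ ε > 0, IsCompact {z ∈ U | ε ≤ a - Ψ z} := fun ε hε => by
    convert hex (a - ε) using 1
    ext z
    simp only [hUdef, mem_inter_iff, mem_preimage, mem_Iio, mem_ofPred_eq]
    constructor
    · rintro ⟨⟨h1, h2⟩, h3⟩; exact ⟨h1, by linarith⟩
    · rintro ⟨h1, h2⟩; exact ⟨⟨h1, by linarith⟩, by linarith⟩
  obtain ⟨Q, hQ⟩ : ∃ Q, ∀ z ∈ U,
      ∑ j, ‖dbarCoord n (fun w => ((a - Ψ w : ℝ) : ℂ)) j z‖ ^ 2 ≤ Q := by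
    have hc : ContinuousOn (fun z => ∑ j, ‖dbarCoord n (fun w => ((a - Ψ w : ℝ) : ℂ)) j z‖ ^ 2) Ω :=
      continuousOn_finsetSum _ fun j _ => ((continuousOn_dbarCoord hΩ
        (Complex.ofRealCLM.contDiff.comp_contDiffOn
          (contDiffOn_const.sub (hΨ.of_le (by simp)))) j).norm.pow 2)
    obtain ⟨Q, hQ⟩ := (hex a).exists_bound_of_continuousOn (hc.mono fun z hz => hz.1)
    exact ⟨Q, fun z hz => (le_abs_self _).trans (hQ z ⟨hz.1, (hUa z hz).le⟩)⟩
  have hap := apriori_estimate (s := fun z => a - Ψ z) (Q := max Q 0) hU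
    (contDiffOn_const.sub (hΨ.mono hUΩ)) (fun z hz => sub_pos.2 (hUa z hz)) hsc
    (fun z hz => (hQ z hz).trans (le_max_left _ _)) hW hB.le (le_max_right _ _)
    (fun z hz ξ => le_hessC_add_inv_pow (hφ.contDiffAt (hΩ.mem_nhds (hUΩ hz)))
      ((hΨ.of_le two_le_infty).contDiffAt (hΩ.mem_nhds (hUΩ hz))) (hUa z hz) (hHφ z (hUΩ hz) ξ)
      (hHΨ z (hUΩ hz) ξ)) hhc hhs (hhK.trans (iUnion_subset fun j => (hτU j).2.2)) ht hta htb
  have hp := htc α (fun j => (hα j).mono_measure (Measure.restrict_mono hUΩ le_rfl))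
    (hαc.mono hUΩ hΩ.measurableSet)
  have e1 : ∀ j, ∫ z in U, τ j z * α j z = ∫ z in Ω, τ j z * α j z := fun j => by
    have := setIntegral_mul_eq_of_tsupport_subset (f := α j) hUΩ hΩ.measurableSet (hτU j).2.2
    simpa only [mul_comm] using this
  simp only [e1] at hp
  have hαi : ∀ j, IntegrableOn (fun z => ‖α j z‖ ^ 2) Ω := fun j =>
    (hα j).integrable_norm_pow (by simp)
  have e2 : ∑ j, ∫ z in U, ‖α j z‖ ^ 2 * Real.exp (-W z) ≤
      Real.exp A * ∑ j, ∫ z in Ω, ‖α j z‖ ^ 2 := by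
    rw [Finset.mul_sum]
    refine Finset.sum_le_sum fun j _ => ?_
    calc ∫ z in U, ‖α j z‖ ^ 2 * Real.exp (-W z) ≤ ∫ z in U, Real.exp A * ‖α j z‖ ^ 2 := by
          refine integral_mono_of_nonneg (Eventually.of_forall fun z => by positivity)
            (((hαi j).mono_set hUΩ).const_mul _)
            (ae_restrict_of_forall_mem hU.measurableSet fun z hz => ?_)
          simp only
          rw [mul_comm]
          gcongr
          linarith [hWA z hz]
      _ ≤ Real.exp A * ∫ z in Ω, ‖α j z‖ ^ 2 := by
          rw [integral_const_mul]
          exact mul_le_mul_of_nonneg_left (setIntegral_mono_set (hαi j)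
            (Eventually.of_forall fun z => by positivity) (LE.le.eventuallyLE hUΩ))
            (Real.exp_pos _).le
  have e3 : ∫ z, ‖h z‖ ^ 2 * Real.exp (W z) ≤
      Real.exp (A + ((a - a₀) ^ 4)⁻¹) * ∫ z, ‖h z‖ ^ 2 := by
    rw [← integral_const_mul]
    refine integral_mono_of_nonneg (Eventually.of_forall fun z => by positivity)
      (((hhc.memLp_of_hasCompactSupport hhs).integrable_norm_pow (p := 2) (by simp)).const_mul _)
      (Eventually.of_forall fun z => ?_)
    by_cases hz : z ∈ ⋃ j, tsupport (τ j)
    · obtain ⟨j, hj⟩ := mem_iUnion.1 hz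
      have h1 := hτa j z hj
      have h2 := (abs_le.1 (hbd z ((hτ j).2.2 hj))).2
      have h3 : 0 < a - a₀ := sub_pos.2 ha
      simp only [hWdef]
      rw [mul_comm]
      gcongr
    · simp [hh0 z hz]
  set P := ∑ j, ∫ z in Ω, ‖α j z‖ ^ 2 with hP
  set R := ∫ z, ‖h z‖ ^ 2 with hR
  have hP0 : 0 ≤ P := by positivity
  have e4 : ∑ j, ∫ z in U, ‖t j z‖ ^ 2 ≤ 2 / B * (Real.exp (A + ((a - a₀) ^ 4)⁻¹) * R) := by
    rw [div_mul_eq_mul_div, le_div_iff₀ hB]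
    linarith
  calc ‖∑ j, ∫ z in Ω, τ j z * α j z‖ ^ 2
      ≤ (Real.exp A * P) * (2 / B * (Real.exp (A + ((a - a₀) ^ 4)⁻¹) * R)) :=
        hp.trans (mul_le_mul e2 e4 (by positivity) (by positivity))
    _ = _ := by
        rw [two_mul, add_assoc, Real.exp_add A (A + _)]
        generalize Real.exp (A + ((a - a₀) ^ 4)⁻¹) = x
        ring

/-- The a priori inequality for closed forms paired with test forms. -/
lemma norm_sum_integral_test_mul_sq_le (hΩ : IsOpen Ω) (hφ : ContDiffOn ℝ 2 φ Ω) (hB : 0 < B)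
    (hbd : ∀ z ∈ Ω, |φ z| ≤ A) (hHφ : ∀ z ∈ Ω, ∀ ξ, B * enormSq n ξ ≤ hessC n φ z ξ)
    (hpsc : Pseudoconvex n Ω) {τ : Fin n → (Fin n → ℂ) → ℂ}
    (hτ : ∀ j, IsTest n Ω (τ j)) {α : Fin n → (Fin n → ℂ) → ℂ}
    (hα : ∀ j, MemLp (α j) 2 (volume.restrict Ω)) (hαc : DbarClosed n Ω α) :
    ‖∑ j, ∫ z in Ω, τ j z * α j z‖ ^ 2 ≤ 2 / B * Real.exp (2 * A) *
      (∑ j, ∫ z in Ω, ‖α j z‖ ^ 2) * ∫ z, ‖∑ j, dbarCoord n (τ j) j z‖ ^ 2 := by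
  obtain ⟨Φ, hΦ, hHΦ, hex⟩ := hpsc
  have hn : ∀ ξ : Fin n → ℂ, 0 ≤ enormSq n ξ := fun ξ =>
    Finset.sum_nonneg fun j _ => Complex.normSq_nonneg _
  have hΨ : ContDiffOn ℝ (⊤ : ℕ∞) (fun z => Φ z + enormSq n z) Ω :=
    hΦ.add contDiff_enormSq.contDiffOn
  have hHΨ : ∀ z ∈ Ω, ∀ ξ, enormSq n ξ ≤ hessC n (fun z => Φ z + enormSq n z) z ξ := by
    intro z hz ξ
    rw [hessC_add ((hΦ.of_le two_le_infty).contDiffAt (hΩ.mem_nhds hz))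
      contDiff_enormSq.contDiffAt, hessC_enormSq]
    linarith [hHΦ z hz ξ]
  have hexΨ : ∀ c, IsCompact {z ∈ Ω | Φ z + enormSq n z ≤ c} := by
    intro c
    obtain ⟨h1, h2⟩ := hex (c + 1)
    have h3 : {z ∈ Ω | Φ z + enormSq n z ≤ c} = closure {z ∈ Ω | Φ z < c + 1} ∩
        (fun z => Φ z + enormSq n z) ⁻¹' Iic c := by
      ext z
      simp only [mem_ofPred_eq, mem_inter_iff, mem_preimage, mem_Iic]
      refine ⟨fun h => ⟨subset_closure ⟨h.1, ?_⟩, h.2⟩, fun h => ⟨h2 h.1, h.2⟩⟩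
      linarith [hn z, h.2]
    rw [h3]
    exact h1.of_isClosed_subset ((hΨ.continuousOn.mono h2).preimage_isClosed_of_isClosed
      h1.isClosed isClosed_Iic) inter_subset_left
  obtain ⟨a₀, ha₀⟩ : ∃ a₀, ∀ j, ∀ z ∈ tsupport (τ j), Φ z + enormSq n z ≤ a₀ := by
    obtain ⟨a₀, h⟩ := (isCompact_iUnion fun j => (hτ j).2.1).exists_bound_of_continuousOn
      (hΨ.continuousOn.mono (iUnion_subset fun j => (hτ j).2.2))
    exact ⟨a₀, fun j z hz => (le_abs_self _).trans (h z (mem_iUnion.2 ⟨j, hz⟩))⟩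
  have key : ∀ k : ℕ, _ := fun k => norm_sum_integral_test_mul_sq_le_of_lt hΩ hφ hB hbd hHφ hΨ hHΨ
    hexΨ hτ (a := a₀ + (k + 1)) ha₀ (by linarith [k.cast_nonneg (α := ℝ)]) hα hαc
  have hlim : Tendsto (fun k : ℕ => Real.exp (2 * A + ((a₀ + (k + 1) - a₀ : ℝ) ^ 4)⁻¹)) atTop
      (𝓝 (Real.exp (2 * A + 0))) := by
    refine (Real.continuous_exp.tendsto _).comp (tendsto_const_nhds.add ?_)
    simp only [add_sub_cancel_left]
    exact (tendsto_inv_atTop_zero.comp (tendsto_pow_atTop (by norm_num))).comp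
      (tendsto_atTop_add_const_right _ _ tendsto_natCast_atTop_atTop)
  rw [add_zero] at hlim
  exact ge_of_tendsto' (((hlim.const_mul (2 / B)).mul_const _).mul_const _) key

end ClosedForms

section ClosedRange

open Filter Topology
open scoped ComplexConjugate

lemma exists_forall_eq_inner {E H : Type*} [AddCommGroup E] [Module ℂ E] [NormedAddCommGroup H]
    [InnerProductSpace ℂ H] [CompleteSpace H] (L : E →ₗ[ℂ] H) (ℓ : E →ₗ[ℂ] ℂ) (C : ℝ)
    (h : ∀ x, ‖ℓ x‖ ≤ C * ‖L x‖) : ∃ u, ∀ x, ℓ x = inner ℂ u (L x) := by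
  have hker : LinearMap.ker L ≤ LinearMap.ker ℓ := fun x hx => by
    have := h x
    rw [LinearMap.mem_ker.1 hx, norm_zero, mul_zero] at this
    exact norm_le_zero_iff.1 this
  set g : LinearMap.range L →ₗ[ℂ] ℂ := (LinearMap.ker L).liftQ ℓ hker ∘ₗ
    L.quotKerEquivRange.symm.toLinearMap with hg
  have hgL : ∀ x, g ⟨L x, LinearMap.mem_range_self L x⟩ = ℓ x := fun x => by
    have : L.quotKerEquivRange.symm ⟨L x, LinearMap.mem_range_self L x⟩ =
        (LinearMap.ker L).mkQ x := L.quotKerEquivRange_symm_apply_image x _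
    simp [hg, this]
  obtain ⟨f, hf, -⟩ := exists_extension_norm_eq (LinearMap.range L) (g.mkContinuous C (by
    rintro ⟨_, x, rfl⟩
    rw [hgL]
    exact h x))
  refine ⟨(InnerProductSpace.toDual ℂ H).symm f, fun x => ?_⟩
  rw [InnerProductSpace.toDual_symm_apply, ← hgL x]
  exact (hf ⟨L x, LinearMap.mem_range_self L x⟩).symm

variable {n : ℕ} {Ω : Set (Fin n → ℂ)}

/-- The space of test functions on `Ω`. -/
def testFunctions (n : ℕ) (Ω : Set (Fin n → ℂ)) : Submodule ℂ ((Fin n → ℂ) → ℂ) where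
  carrier := {σ | IsTest n Ω σ}
  zero_mem' := ⟨contDiff_const, HasCompactSupport.zero, by simp [tsupport]⟩
  add_mem' := fun h₁ h₂ => ⟨h₁.1.add h₂.1, h₁.2.1.add h₂.2.1,
    (tsupport_add _ _).trans (union_subset h₁.2.2 h₂.2.2)⟩
  smul_mem' := fun c _ h => ⟨contDiff_const.smul h.1, h.2.1.smul_left (f := fun _ => c),
    (tsupport_smul_subset_right (fun _ => c) _).trans h.2.2⟩

lemma dbarCoord_add {f g : (Fin n → ℂ) → ℂ} {z : Fin n → ℂ} (hf : DifferentiableAt ℝ f z)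
    (hg : DifferentiableAt ℝ g z) (j : Fin n) :
    dbarCoord n (f + g) j z = dbarCoord n f j z + dbarCoord n g j z := by
  simp only [dbarCoord, fderiv_add hf hg, add_apply]
  ring

lemma dbarCoord_const_smul (c : ℂ) {f : (Fin n → ℂ) → ℂ} {z : Fin n → ℂ}
    (hf : DifferentiableAt ℝ f z) (j : Fin n) :
    dbarCoord n (c • f) j z = c * dbarCoord n f j z := by
  simp only [dbarCoord, fderiv_const_smul hf, smul_apply, smul_eq_mul]
  ring

lemma IsTest.memLp {σ : (Fin n → ℂ) → ℂ} (hσ : IsTest n Ω σ) (μ : Measure (Fin n → ℂ))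
    [IsFiniteMeasureOnCompacts μ] : MemLp σ 2 μ :=
  hσ.1.continuous.memLp_of_hasCompactSupport hσ.2.1

lemma IsTest.differentiable {σ : (Fin n → ℂ) → ℂ} (hσ : IsTest n Ω σ) : Differentiable ℝ σ :=
  hσ.1.differentiable (by simp)

lemma isTest_divergence {τ : Fin n → (Fin n → ℂ) → ℂ} (hτ : ∀ j, IsTest n Ω (τ j)) :
    IsTest n Ω fun z => ∑ j, dbarCoord n (τ j) j z := by
  have := (testFunctions n Ω).sum_mem (t := Finset.univ) fun j _ => (hτ j).dbarCoord j
  convert (show IsTest n Ω _ from this) using 1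
  ext z
  simp

/-- The formal adjoint of `∂̄`, as a map from test forms to square-integrable functions. -/
def divergence (n : ℕ) (Ω : Set (Fin n → ℂ)) :
    (Fin n → testFunctions n Ω) →ₗ[ℂ] Lp ℂ 2 (volume.restrict Ω) where
  toFun τ := ((isTest_divergence fun j => (τ j).2).memLp _).toLp _
  map_add' τ σ := by
    rw [← MemLp.toLp_add]
    congr 1
    ext z
    simp only [Pi.add_apply, ← Finset.sum_add_distrib, Submodule.coe_add]
    exact Finset.sum_congr rfl fun j _ => dbarCoord_add
      (IsTest.differentiable (τ j).2 z) (IsTest.differentiable (σ j).2 z) j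
  map_smul' c τ := by
    rw [RingHom.id_apply, ← MemLp.toLp_const_smul]
    congr 1
    ext z
    simp only [Pi.smul_apply, Submodule.coe_smul, smul_eq_mul, Finset.mul_sum]
    exact Finset.sum_congr rfl fun j _ => dbarCoord_const_smul c
      (IsTest.differentiable (τ j).2 z) j

lemma IsTest.integrable_mul {σ f : (Fin n → ℂ) → ℂ} (hσ : IsTest n Ω σ)
    (hf : MemLp f 2 (volume.restrict Ω)) : Integrable (fun z => σ z * f z) (volume.restrict Ω) :=
  (hσ.memLp _).integrable_mul hf

/-- Integration of test forms against a square-integrable form. -/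
def testPairing {α : Fin n → (Fin n → ℂ) → ℂ} (hα : ∀ j, MemLp (α j) 2 (volume.restrict Ω)) :
    (Fin n → testFunctions n Ω) →ₗ[ℂ] ℂ where
  toFun τ := ∑ j, ∫ z in Ω, (τ j : (Fin n → ℂ) → ℂ) z * α j z
  map_add' τ σ := by
    rw [← Finset.sum_add_distrib]
    refine Finset.sum_congr rfl fun j _ => ?_
    rw [← integral_add (IsTest.integrable_mul (τ j).2 (hα j))
      (IsTest.integrable_mul (σ j).2 (hα j))]
    simp [add_mul]
  map_smul' c τ := by
    rw [RingHom.id_apply, smul_eq_mul, Finset.mul_sum]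
    refine Finset.sum_congr rfl fun j _ => ?_
    rw [← integral_const_mul]
    simp [mul_assoc]

lemma exists_dbarEq_of_norm_sq_le {α : Fin n → (Fin n → ℂ) → ℂ}
    (hα : ∀ j, MemLp (α j) 2 (volume.restrict Ω)) {C : ℝ}
    (h : ∀ τ : Fin n → (Fin n → ℂ) → ℂ, (∀ j, IsTest n Ω (τ j)) →
      ‖∑ j, ∫ z in Ω, τ j z * α j z‖ ^ 2 ≤ C * ∫ z in Ω, ‖∑ j, dbarCoord n (τ j) j z‖ ^ 2) :
    ∃ u : Lp ℂ 2 (volume.restrict Ω), DbarEq n Ω u α := by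
  obtain ⟨u, hu⟩ := exists_forall_eq_inner (divergence n Ω) (testPairing hα) (√C) fun τ => by
    have hτ := isTest_divergence fun j => (τ j).2
    have h1 := h (fun j => τ j) fun j => (τ j).2
    rw [integral_norm_sq_eq (hτ.memLp _), ← Lp.norm_toLp _ (hτ.memLp _)] at h1
    refine (Real.le_sqrt_of_sq_le h1).trans ?_
    rw [Real.sqrt_mul' _ (sq_nonneg _), Real.sqrt_sq (norm_nonneg _)]
    rfl
  refine ⟨-star u, fun j σ hσ => ?_⟩
  classical
  have h1 := hu (Pi.single j ⟨σ, hσ⟩)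
  have e1 : testPairing hα (Pi.single j ⟨σ, hσ⟩) = ∫ z in Ω, α j z * σ z := by
    refine (Finset.sum_eq_single j (fun k _ hk => ?_)
      fun h => absurd (Finset.mem_univ j) h).trans ?_
    · simp [Pi.single_eq_of_ne hk]
    · simp [mul_comm]
  rw [← e1, h1, L2.inner_def, ← integral_neg]
  refine integral_congr_ae ?_
  have hd := isTest_divergence fun k => ((Pi.single j ⟨σ, hσ⟩ : Fin n → testFunctions n Ω) k).2
  filter_upwards [(hd.memLp (volume.restrict Ω)).coeFn_toLp, Lp.coeFn_neg (star u),
    Lp.coeFn_star u] with z h2 h3 h4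
  have e2 : ∑ k, dbarCoord n ((Pi.single j ⟨σ, hσ⟩ : Fin n → testFunctions n Ω) k) k z =
      dbarCoord n σ j z := by
    refine (Finset.sum_eq_single j (fun k _ hk => ?_)
      fun h => absurd (Finset.mem_univ j) h).trans ?_
    · simp [Pi.single_eq_of_ne hk, dbarCoord]
    · simp
  change inner ℂ (u z) ((hd.memLp (volume.restrict Ω)).toLp _ z) = _
  rw [h2, e2, h3, Pi.neg_apply, h4, RCLike.inner_apply']
  simp

lemma DbarEq.dbarClosed {u : (Fin n → ℂ) → ℂ} {α : Fin n → (Fin n → ℂ) → ℂ}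
    (h : DbarEq n Ω u α) : DbarClosed n Ω α := fun j k σ hσ => by
  rw [h j _ (hσ.dbarCoord k), h k _ (hσ.dbarCoord j)]
  have hσ2 : ContDiff ℝ 2 σ := hσ.1.of_le two_le_infty
  simp only [dbarCoord_dbarCoord_comm hσ2.contDiffAt j k]

lemma continuous_setIntegral_mul_test {σ : (Fin n → ℂ) → ℂ} (hσ : IsTest n Ω σ) :
    Continuous fun f : Lp ℂ 2 (volume.restrict Ω) => ∫ z in Ω, f z * σ z := by
  have h : ∀ f : Lp ℂ 2 (volume.restrict Ω), ∫ z in Ω, f z * σ z =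
      inner ℂ (star ((hσ.memLp (volume.restrict Ω)).toLp σ)) f := fun f => by
    rw [L2.inner_def]
    refine integral_congr_ae ?_
    filter_upwards [(hσ.memLp (volume.restrict Ω)).coeFn_toLp,
      Lp.coeFn_star ((hσ.memLp (volume.restrict Ω)).toLp σ)] with z h1 h2
    rw [h2, Pi.star_apply, h1, RCLike.inner_apply']
    simp [mul_comm]
  simp only [h]
  exact continuous_const.inner continuous_id

lemma isClosed_setOf_dbarClosed :
    IsClosed {α : Fin n → Lp ℂ 2 (volume.restrict Ω) | DbarClosed n Ω fun j => α j} := by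
  simp only [DbarClosed, ofPred_forall]
  exact isClosed_iInter fun j => isClosed_iInter fun k => isClosed_iInter fun σ =>
    isClosed_iInter fun hσ => isClosed_eq
      ((continuous_setIntegral_mul_test (hσ.dbarCoord k)).comp (continuous_apply j))
      ((continuous_setIntegral_mul_test (hσ.dbarCoord j)).comp (continuous_apply k))

end ClosedRange

/-- **Corollary 6.2 (q = 0).** If `Ω ⊆ ℂⁿ` is a pseudoconvex domain admitting a real-valued
`φ ∈ C²(Ω)` and constants `A, B > 0` with `|φ| ≤ A` on `Ω` and `Hφ(z;ξ) ≥ B|ξ|²` for all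
`z ∈ Ω`, `ξ ∈ ℂⁿ`, then `∂̄` has closed range:
`R(∂̄) = {α ∈ (L²(Ω))ⁿ : ∃u ∈ L²(Ω), ∂̄u = α}` is closed in `(L²(Ω))ⁿ`. -/
theorem closed_range_of_bounded_weight
    {n : ℕ} (Ω : Set (Fin n → ℂ)) (hne : Ω.Nonempty) (hop : IsOpen Ω)
    (hconn : IsConnected Ω) (hpsc : Pseudoconvex n Ω)
    (φ : (Fin n → ℂ) → ℝ) (hφ : ContDiffOn ℝ 2 φ Ω)
    (A B : ℝ) (hA : 0 < A) (hB : 0 < B)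
    (hbdφ : ∀ z ∈ Ω, |φ z| ≤ A)
    (hhess : ∀ z ∈ Ω, ∀ ξ : Fin n → ℂ, B * enormSq n ξ ≤ hessC n φ z ξ) :
    IsClosed {α : Fin n → Lp ℂ 2 ((volume : Measure (Fin n → ℂ)).restrict Ω) |
      ∃ u : Lp ℂ 2 ((volume : Measure (Fin n → ℂ)).restrict Ω),
        DbarEq n Ω (⇑u) (fun j => ⇑(α j))} := by
  convert isClosed_setOf_dbarClosed (n := n) (Ω := Ω) using 1
  ext α
  refine ⟨fun ⟨_, hu⟩ => hu.dbarClosed, fun hα => ?_⟩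
  refine exists_dbarEq_of_norm_sq_le (fun j => Lp.memLp (α j))
    (C := 2 / B * Real.exp (2 * A) * ∑ j, ∫ z in Ω, ‖α j z‖ ^ 2) fun τ hτ => ?_
  rw [setIntegral_eq_integral_of_forall_compl_eq_zero fun z hz => ?_]
  · exact norm_sum_integral_test_mul_sq_le hop hφ hB hbdφ hhess hpsc hτ
      (fun j => Lp.memLp (α j)) hα
  · have h0 := image_eq_zero_of_notMem_tsupport fun h => hz ((isTest_divergence hτ).2.2 h)
    simp [h0]
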